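/- Fix D ∈ (0,1). Then the following are equivalent: (a) ζ(D + iτ) ≠ 0 for every τ ∈ ℝ (i.e., the Riemann zeta function has no zeroes on the vertical line Re(s) = D); (b) for every ordinary fractal string Ω of dimension D, if there exist constants c_D > 0 and δ > 0 such that N_ν(x) = W(x) − c_D x^D + O(x^{D−δ}) as x → +∞, then Ω is Minkowski measurable of dimension D. -/

import Mathlib

open MeasureTheory Filter Topology Asymptotics

/-- An ordinary fractal string: a bounded open subset `Ω ⊆ ℝ` realized as a
countable disjoint union of (infinitely many) nonempty open intervals, whose
lengths `l_j = b_j - a_j` are listed in nonincreasing order. -/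
structure FractalString where
  a : ℕ → ℝ
  b : ℕ → ℝ
  lt : ∀ j, a j < b j
  disj : Pairwise fun i j => Disjoint (Set.Ioo (a i) (b i)) (Set.Ioo (a j) (b j))
  bdd : Bornology.IsBounded (⋃ j, Set.Ioo (a j) (b j))
  anti : Antitone fun j => b j - a j

namespace FractalString

/-- The lengths `l_j` of the string. -/
def l (S : FractalString) (j : ℕ) : ℝ := S.b j - S.a j

/-- The bounded open set `Ω ⊆ ℝ` of the string. -/
def Omega (S : FractalString) : Set ℝ := ⋃ j, Set.Ioo (S.a j) (S.b j)

/-- The inner `ε`-neighborhood `Ω_ε = {x ∈ Ω : dist(x, ∂Ω) < ε}` of `∂Ω`. -/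
def innerNbhd (S : FractalString) (ε : ℝ) : Set ℝ :=
  {x ∈ S.Omega | Metric.infDist x (frontier S.Omega) < ε}

/-- The dimension of the string: the abscissa of convergence
`D = inf{σ : Σ_j l_j^σ < ∞}` of its geometric zeta function. -/
noncomputable def dimension (S : FractalString) : ℝ :=
  sInf {σ : ℝ | Summable fun j => S.l j ^ σ}

/-- The spectral counting function `N_ν(x) = Σ_j ⌊l_j x⌋`. -/
noncomputable def Nnu (S : FractalString) (x : ℝ) : ℝ :=
  ∑' j : ℕ, (⌊S.l j * x⌋ : ℝ)

/-- The Weyl term `W(x) = vol₁(Ω)·x = (Σ_j l_j)·x`. -/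
noncomputable def weyl (S : FractalString) (x : ℝ) : ℝ :=
  (∑' j : ℕ, S.l j) * x

/-- `vol₁(Ω_ε)/ε^{1-D} → M` as `ε → 0⁺`. -/
def MinkTendsto (S : FractalString) (D M : ℝ) : Prop :=
  Tendsto (fun ε : ℝ => (volume (S.innerNbhd ε)).toReal / ε ^ (1 - D))
    (𝓝[>] 0) (𝓝 M)

/-- The string is Minkowski measurable of dimension `D`: the limit
`M = lim_{ε→0⁺} vol₁(Ω_ε)/ε^{1-D}` exists in `(0, ∞)`. -/
def MinkowskiMeasurable (S : FractalString) (D : ℝ) : Prop :=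
  ∃ M, 0 < M ∧ S.MinkTendsto D M

/-- The geometric counting function `N_L(x) = #{j : l_j ≥ 1/x}`. -/
noncomputable def NL (S : FractalString) (x : ℝ) : ℕ :=
  {j : ℕ | 1 / x ≤ S.l j}.ncard

end FractalString

section Mellin

open Set Complex

/-- The fractional part truncated to `(1, ∞)`, whose Mellin transform is holomorphic in
`Re s < 0`. -/
noncomputable def fractTail : ℝ → ℂ := (Ioi (1 : ℝ)).indicator fun x => ((Int.fract x : ℝ) : ℂ)

lemma measurable_fractTail : Measurable fractTail :=
  (Complex.measurable_ofReal.comp measurable_fract).indicator measurableSet_Ioi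

lemma norm_ofReal_fract_le (x : ℝ) : ‖((Int.fract x : ℝ) : ℂ)‖ ≤ 1 := by
  rw [Complex.norm_real, Real.norm_of_nonneg (Int.fract_nonneg x)]
  exact (Int.fract_lt_one x).le

lemma norm_fractTail_le (x : ℝ) : ‖fractTail x‖ ≤ 1 :=
  (norm_indicator_le_norm_self _ _).trans (norm_ofReal_fract_le x)

lemma locallyIntegrableOn_of_bounded {f : ℝ → ℂ} (hf : Measurable f) (h : ∀ x, ‖f x‖ ≤ 1)
    (s : Set ℝ) : LocallyIntegrableOn f s := by
  apply LocallyIntegrable.locallyIntegrableOn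
  intro x
  refine ⟨Icc (x - 1) (x + 1), Icc_mem_nhds (by linarith) (by linarith), ?_⟩
  exact Measure.integrableOn_of_bounded (M := 1) (by simp) hf.aestronglyMeasurable
    (Eventually.of_forall h)

lemma isBigO_atTop_of_bounded {f : ℝ → ℂ} (h : ∀ x, ‖f x‖ ≤ 1) :
    f =O[atTop] fun x : ℝ => x ^ (-(0 : ℝ)) := by
  refine IsBigO.of_bound 1 (Eventually.of_forall fun x => ?_)
  simpa using h x

lemma fractTail_isBigO_zero (b : ℝ) : fractTail =O[𝓝[>] 0] fun x : ℝ => x ^ (-b) := by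
  refine IsBigO.of_bound 1 ?_
  filter_upwards [Ioo_mem_nhdsGT (zero_lt_one (α := ℝ))] with x hx
  rw [fractTail, indicator_of_notMem (by simpa using hx.2.le)]
  simp only [norm_zero]
  positivity

lemma differentiableAt_mellin_fractTail {s : ℂ} (hs : s.re < 0) :
    DifferentiableAt ℂ (mellin fractTail) s :=
  mellin_differentiableAt_of_isBigO_rpow (a := 0) (b := s.re - 1)
    (locallyIntegrableOn_of_bounded measurable_fractTail norm_fractTail_le _)
    (isBigO_atTop_of_bounded norm_fractTail_le) hs (fractTail_isBigO_zero _) (by linarith)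

lemma mellinConvergent_fractTail {s : ℂ} (hs : s.re < 0) : MellinConvergent fractTail s :=
  mellinConvergent_of_isBigO_rpow (a := 0) (b := s.re - 1)
    (locallyIntegrableOn_of_bounded measurable_fractTail norm_fractTail_le _)
    (isBigO_atTop_of_bounded norm_fractTail_le) hs (fractTail_isBigO_zero _) (by linarith)

lemma mellin_fractTail (s : ℂ) :
    mellin fractTail s = ∫ t : ℝ in Ioi 1, (t : ℂ) ^ (s - 1) * ((Int.fract t : ℝ) : ℂ) := by
  have h : ∀ t : ℝ, (t : ℂ) ^ (s - 1) • fractTail t =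
      (Ioi (1 : ℝ)).indicator (fun t : ℝ => (t : ℂ) ^ (s - 1) * ((Int.fract t : ℝ) : ℂ)) t := by
    intro t
    by_cases ht : t ∈ Ioi (1 : ℝ) <;> simp [fractTail, ht]
  rw [mellin]
  simp_rw [h]
  rw [setIntegral_indicator measurableSet_Ioi, Ioi_inter_Ioi]
  simp

lemma integrableOn_cpow_mul_fract {s : ℂ} (hs : s.re < 0) :
    IntegrableOn (fun t : ℝ => (t : ℂ) ^ (s - 1) * ((Int.fract t : ℝ) : ℂ)) (Ioi 1) := by
  have h := (mellinConvergent_fractTail hs).mono_set (Ioi_subset_Ioi zero_le_one)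
  refine h.congr_fun (fun t ht => ?_) measurableSet_Ioi
  simp [fractTail, indicator_of_mem ht]

lemma riemannZeta_eq_of_one_lt_re {s : ℂ} (hs : 1 < s.re) :
    riemannZeta s = s / (s - 1) - s * mellin fractTail (-s) := by
  have h1 : LSeries (fun n : ℕ => (((1 : ℕ → ℝ) n : ℝ) : ℂ)) s = _ :=
    LSeries_eq_mul_integral_of_nonneg (1 : ℕ → ℝ) zero_le_one hs (by
      refine IsBigO.of_bound 1 (Eventually.of_forall fun n => ?_)
      simp) (fun n => by simp)
  have h2 : (fun n : ℕ => (((1 : ℕ → ℝ) n : ℝ) : ℂ)) = 1 := by ext; simp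
  rw [h2, LSeries_one_eq_riemannZeta hs] at h1
  have h3 : ∀ t ∈ Ioi (1 : ℝ), (∑ k ∈ Finset.Icc 1 ⌊t⌋₊, (((1 : ℕ → ℝ) k : ℝ) : ℂ)) *
      (t : ℂ) ^ (-(s + 1)) =
      (t : ℂ) ^ (-s) - (t : ℂ) ^ (-s - 1) * ((Int.fract t : ℝ) : ℂ) := by
    intro t ht
    have ht0 : 0 < t := zero_lt_one.trans ht
    have h4 : (t : ℂ) ^ (-s) = (t : ℂ) ^ (-s - 1) * t := by
      have ht0' : (t : ℂ) ≠ 0 := by exact_mod_cast ht0.ne'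
      rw [cpow_sub _ _ ht0', cpow_one, div_mul_cancel₀ _ ht0']
    have h5 : ((⌊t⌋₊ : ℕ) : ℂ) = t - ((Int.fract t : ℝ) : ℂ) := by
      have : ((⌊t⌋₊ : ℕ) : ℝ) = t - Int.fract t := by
        rw [natCast_floor_eq_intCast_floor ht0.le, Int.self_sub_fract]
      exact_mod_cast congrArg (fun x : ℝ => (x : ℂ)) this
    have h6 : -(s + 1) = -s - 1 := by ring
    rw [h4, h6]
    simp only [Pi.one_apply, ofReal_one, Finset.sum_const, Nat.card_Icc, add_tsub_cancel_right,
      nsmul_eq_mul, mul_one]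
    rw [h5]; ring
  have hs0 : (-s).re < -1 := by simpa using hs
  have hs1 : s - 1 ≠ 0 := by
    intro h; rw [sub_eq_zero] at h; simp [h] at hs
  have hs2 : (-s).re < 0 := by linarith
  rw [h1.trans (congrArg (s * ·) (setIntegral_congr_fun measurableSet_Ioi h3)),
    integral_sub (integrableOn_Ioi_cpow_of_lt hs0 zero_lt_one)
      (integrableOn_cpow_mul_fract hs2),
    integral_Ioi_cpow_of_lt hs0 zero_lt_one, mellin_fractTail]
  have hs3 : -s + 1 ≠ 0 := by
    intro h; apply hs1; linear_combination -h
  simp only [ofReal_one, one_cpow]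
  field_simp
  ring

lemma riemannZeta_eq_of_pos_re {s : ℂ} (hs : 0 < s.re) (hs1 : s ≠ 1) :
    riemannZeta s = s / (s - 1) - s * mellin fractTail (-s) := by
  have hU : IsOpen ({s : ℂ | 0 < s.re} \ {1}) :=
    (isOpen_lt continuous_const Complex.continuous_re).sdiff isClosed_singleton
  have hpre : IsPreconnected ({s : ℂ | 0 < s.re} \ {1}) := by
    have hA := ((convex_halfSpace_re_gt 0).inter (convex_halfSpace_im_gt 0)).isPreconnected
    have hB := ((convex_halfSpace_re_gt 0).inter (convex_halfSpace_im_lt 0)).isPreconnected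
    have hC := (convex_halfSpace_re_gt 1).isPreconnected
    have hE := ((convex_halfSpace_re_gt 0).inter (convex_halfSpace_re_lt 1)).isPreconnected
    have h1 := IsPreconnected.union (2 + I) (by simp) (by simp) hA hC
    have h2 := IsPreconnected.union (2 - I) (by simp) (by simp) h1 hB
    have h3 := IsPreconnected.union (1 / 2 + I) (by simp) (by norm_num) h2 hE
    convert h3 using 1
    ext z
    simp only [Set.mem_sdiff, mem_ofPred_eq, mem_singleton_iff, mem_union, mem_inter_iff, Complex.ext_iff,
      one_re, one_im]
    constructor
    · rintro ⟨h0, h⟩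
      rcases lt_trichotomy z.im 0 with h4 | h4 | h4
      · tauto
      · rcases lt_trichotomy z.re 1 with h5 | h5 | h5 <;> tauto
      · tauto
    · rintro (((⟨h4, h5⟩ | h4) | ⟨h4, h5⟩) | ⟨h4, h5⟩)
      · exact ⟨h4, fun h => h5.ne' h.2⟩
      · exact ⟨by linarith, fun h => h4.ne' h.1⟩
      · exact ⟨h4, fun h => h5.ne h.2⟩
      · exact ⟨h4, fun h => h5.ne h.1⟩
  have hf : AnalyticOnNhd ℂ riemannZeta ({s : ℂ | 0 < s.re} \ {1}) := by
    refine DifferentiableOn.analyticOnNhd (fun z hz => ?_) hU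
    exact (differentiableAt_riemannZeta hz.2).differentiableWithinAt
  have hg : AnalyticOnNhd ℂ (fun s => s / (s - 1) - s * mellin fractTail (-s))
      ({s : ℂ | 0 < s.re} \ {1}) := by
    refine DifferentiableOn.analyticOnNhd (fun z hz => ?_) hU
    refine DifferentiableAt.differentiableWithinAt ?_
    have h1 : DifferentiableAt ℂ (fun s => mellin fractTail (-s)) z := by
      have h : (-z).re < 0 := by simpa using hz.1
      exact (differentiableAt_mellin_fractTail h).comp z differentiableAt_id.neg
    have h2 : z - 1 ≠ 0 := sub_ne_zero.mpr hz.2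
    fun_prop (disch := assumption)
  refine hf.eqOn_of_preconnected_of_eventuallyEq hg hpre (z₀ := 2) ?_ ?_ ⟨hs, hs1⟩
  · simp
  · filter_upwards [(isOpen_lt continuous_const Complex.continuous_re).mem_nhds
      (show (1 : ℝ) < (2 : ℂ).re by simp)] with z hz
    exact riemannZeta_eq_of_one_lt_re hz

lemma mellin_indicator_Ioc_id {s : ℂ} (hs : s.re < 1) :
    HasMellin ((Ioc (0 : ℝ) 1).indicator fun t : ℝ => (t : ℂ)) (-s) (1 / (1 - s)) := by
  have := hasMellin_cpow_Ioc 1 (s := -s) (by simpa using hs)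
  simpa [sub_eq_neg_add] using this

/-- The Mellin transform of the fractional part on the strip `-1 < Re s < 0`. -/
lemma hasMellin_fract {s : ℂ} (h0 : 0 < s.re) (h1 : s.re < 1) :
    HasMellin (fun t : ℝ => ((Int.fract t : ℝ) : ℂ)) (-s) (-riemannZeta s / s) := by
  have hA := mellin_indicator_Ioc_id h1
  have hB := mellinConvergent_fractTail (s := -s) (by simpa using h0)
  have hAB := hasMellin_add hA.1 hB
  have hae : ∀ᵐ t : ℝ ∂(volume.restrict (Ioi (0 : ℝ))),
      (t : ℂ) ^ (-s - 1) • ((Ioc (0 : ℝ) 1).indicator (fun t : ℝ => (t : ℂ)) t + fractTail t) =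
      (t : ℂ) ^ (-s - 1) • ((Int.fract t : ℝ) : ℂ) := by
    rw [ae_restrict_iff' measurableSet_Ioi]
    have : ∀ᵐ t : ℝ, t ≠ 1 := by simp [ae_iff]
    filter_upwards [this] with t ht1 ht0
    congr 1
    rcases lt_or_gt_of_ne ht1 with h | h
    · rw [indicator_of_mem (show t ∈ Ioc (0 : ℝ) 1 from ⟨ht0, h.le⟩), fractTail, indicator_of_notMem (by simpa using h.le),
        Int.fract_eq_self.mpr ⟨le_of_lt ht0, h⟩, add_zero]
    · rw [indicator_of_notMem (by simp [h]), fractTail, indicator_of_mem (by simpa using h),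
        zero_add]
  refine ⟨Integrable.congr hAB.1 hae, ?_⟩
  have h2 : mellin (fun t : ℝ => ((Int.fract t : ℝ) : ℂ)) (-s) =
      1 / (1 - s) + mellin fractTail (-s) := by
    rw [← hA.2, ← hAB.2]
    exact (integral_congr_ae hae).symm
  have hs0 : s ≠ 0 := by rintro rfl; simp at h0
  have hs1 : s ≠ 1 := by rintro rfl; simp at h1
  have hs2 : s - 1 ≠ 0 := sub_ne_zero.mpr hs1
  have hs3 : 1 - s ≠ 0 := sub_ne_zero.mpr hs1.symm
  rw [h2, riemannZeta_eq_of_pos_re h0 hs1]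
  field_simp
  ring

/-- The Mellin transform of `min t 1` on the strip `-1 < Re s < 0`. -/
lemma hasMellin_min {s : ℂ} (h0 : 0 < s.re) (h1 : s.re < 1) :
    HasMellin (fun t : ℝ => ((min t 1 : ℝ) : ℂ)) (-s) (1 / (s * (1 - s))) := by
  have hA := mellin_indicator_Ioc_id h1
  have hs : (-s - 1).re < -1 := by simp only [sub_re, neg_re, one_re]; linarith
  have hB : HasMellin ((Ioi (1 : ℝ)).indicator fun _ : ℝ => (1 : ℂ)) (-s) (1 / s) := by
    have h : ∀ t : ℝ, (t : ℂ) ^ (-s - 1) • (Ioi (1 : ℝ)).indicator (fun _ : ℝ => (1 : ℂ)) t =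
        (Ioi (1 : ℝ)).indicator (fun t : ℝ => (t : ℂ) ^ (-s - 1)) t := by
      intro t
      by_cases ht : t ∈ Ioi (1 : ℝ) <;> simp [ht]
    constructor
    · rw [MellinConvergent]
      simp_rw [h]
      exact ((integrableOn_Ioi_cpow_of_lt hs zero_lt_one).integrable_indicator
        measurableSet_Ioi).integrableOn
    · rw [mellin]
      simp_rw [h]
      rw [setIntegral_indicator measurableSet_Ioi, Ioi_inter_Ioi]
      simp only [zero_le_one, sup_of_le_right]
      rw [integral_Ioi_cpow_of_lt hs zero_lt_one]
      simp
  have hAB := hasMellin_add hA.1 hB.1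
  have hfun : ∀ t ∈ Ioi (0 : ℝ),
      (t : ℂ) ^ (-s - 1) • ((Ioc (0 : ℝ) 1).indicator (fun t : ℝ => (t : ℂ)) t +
        (Ioi (1 : ℝ)).indicator (fun _ : ℝ => (1 : ℂ)) t) =
      (t : ℂ) ^ (-s - 1) • ((min t 1 : ℝ) : ℂ) := by
    intro t ht
    congr 1
    rcases le_or_gt t 1 with h | h
    · rw [indicator_of_mem (show t ∈ Ioc (0 : ℝ) 1 from ⟨ht, h⟩), indicator_of_notMem (by simpa using h), min_eq_left h, add_zero]
    · rw [indicator_of_notMem (by simp [h]), indicator_of_mem (by simpa using h),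
        min_eq_right h.le, zero_add, ofReal_one]
  have hInt := IntegrableOn.congr_fun hAB.1 hfun measurableSet_Ioi
  refine ⟨hInt, ?_⟩
  have h2 : mellin (fun t : ℝ => ((min t 1 : ℝ) : ℂ)) (-s) = 1 / (1 - s) + 1 / s := by
    rw [← hA.2, ← hB.2, ← hAB.2]
    exact (setIntegral_congr_fun measurableSet_Ioi hfun).symm
  have hs0 : s ≠ 0 := by rintro rfl; simp at h0
  have hs1 : s ≠ 1 := by rintro rfl; simp at h1
  have hs3 : 1 - s ≠ 0 := sub_ne_zero.mpr hs1.symm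
  rw [h2]
  field_simp
  ring

end Mellin

namespace FractalString

open Set

variable (S : FractalString)

lemma l_pos (j : ℕ) : 0 < S.l j := sub_pos.mpr (S.lt j)

lemma tsum_ofReal_l_lt_top : ∑' j, ENNReal.ofReal (S.l j) < ⊤ := by
  have h : volume (⋃ j, Ioo (S.a j) (S.b j)) = ∑' j, ENNReal.ofReal (S.l j) := by
    rw [measure_iUnion S.disj fun _ => measurableSet_Ioo]
    simp [Real.volume_Ioo, l]
  rw [← h]
  exact S.bdd.measure_lt_top

lemma summable_l : Summable S.l := by
  have h := ENNReal.summable_toReal S.tsum_ofReal_l_lt_top.ne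
  simpa [ENNReal.toReal_ofReal (S.l_pos _).le] using h

lemma a_mem_frontier (j : ℕ) : S.a j ∈ frontier S.Omega := by
  have hO : IsOpen S.Omega := isOpen_iUnion fun _ => isOpen_Ioo
  rw [hO.frontier_eq]
  refine ⟨closure_mono (subset_iUnion (fun j => Ioo (S.a j) (S.b j)) j) ?_, ?_⟩
  · rw [closure_Ioo (S.lt j).ne]
    exact left_mem_Icc.mpr (S.lt j).le
  · intro h
    obtain ⟨i, hi⟩ := mem_iUnion.mp h
    have hij : i ≠ j := by rintro rfl; exact lt_irrefl _ hi.1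
    have := Ioo_disjoint_Ioo.mp (S.disj hij)
    have h1 := S.lt j
    have h2 : S.a j < min (S.b i) (S.b j) := lt_min hi.2 h1
    have h3 : max (S.a i) (S.a j) = S.a j := max_eq_right hi.1.le
    rw [h3] at this
    linarith

lemma b_mem_frontier (j : ℕ) : S.b j ∈ frontier S.Omega := by
  have hO : IsOpen S.Omega := isOpen_iUnion fun _ => isOpen_Ioo
  rw [hO.frontier_eq]
  refine ⟨closure_mono (subset_iUnion (fun j => Ioo (S.a j) (S.b j)) j) ?_, ?_⟩
  · rw [closure_Ioo (S.lt j).ne]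
    exact right_mem_Icc.mpr (S.lt j).le
  · intro h
    obtain ⟨i, hi⟩ := mem_iUnion.mp h
    have hij : i ≠ j := by rintro rfl; exact lt_irrefl _ hi.2
    have := Ioo_disjoint_Ioo.mp (S.disj hij)
    have h1 := S.lt j
    have h2 : max (S.a i) (S.a j) < S.b j := max_lt hi.1 h1
    have h3 : min (S.b i) (S.b j) = S.b j := min_eq_right hi.2.le
    rw [h3] at this
    linarith

lemma innerNbhd_eq (ε : ℝ) :
    S.innerNbhd ε = ⋃ j, Ioo (S.a j) (S.b j) \ Icc (S.a j + ε) (S.b j - ε) := by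
  have hO : IsOpen S.Omega := isOpen_iUnion fun _ => isOpen_Ioo
  have hne : (frontier S.Omega).Nonempty := ⟨_, S.a_mem_frontier 0⟩
  have key : ∀ j, ∀ x ∈ Ioo (S.a j) (S.b j), Metric.infDist x (frontier S.Omega) < ε ↔
      x ∉ Icc (S.a j + ε) (S.b j - ε) := by
    intro j x hx
    rw [Metric.infDist_lt_iff hne]
    constructor
    · rintro ⟨y, hy, hxy⟩ ⟨h1, h2⟩
      rw [Real.dist_eq, abs_lt] at hxy
      rw [hO.frontier_eq] at hy
      refine hy.2 (mem_iUnion.mpr ⟨j, ?_, ?_⟩) <;> linarith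
    · intro h
      by_cases h1 : S.a j + ε ≤ x
      · have h2 : S.b j - ε < x := by
          by_contra! h2
          exact h ⟨h1, h2⟩
        refine ⟨_, S.b_mem_frontier j, ?_⟩
        rw [Real.dist_eq, abs_lt]
        constructor <;> linarith [hx.1, hx.2]
      · push Not at h1
        refine ⟨_, S.a_mem_frontier j, ?_⟩
        rw [Real.dist_eq, abs_lt]
        constructor <;> linarith [hx.1, hx.2]
  ext x
  simp only [innerNbhd, Omega, mem_iUnion, Set.mem_sdiff]
  constructor
  · rintro ⟨hx, h⟩
    obtain ⟨j, hj⟩ := hx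
    exact ⟨j, hj, (key j x hj).mp h⟩
  · rintro ⟨j, hj, h⟩
    exact ⟨⟨j, hj⟩, (key j x hj).mpr h⟩

lemma volume_Ioo_diff_Icc {a b ε : ℝ} (hε : 0 < ε) :
    volume (Ioo a b \ Icc (a + ε) (b - ε)) = ENNReal.ofReal (min (b - a) (2 * ε)) := by
  rcases le_or_gt (a + ε) (b - ε) with h | h
  · have hsub : Icc (a + ε) (b - ε) ⊆ Ioo a b :=
      fun x hx => ⟨by linarith [hx.1], by linarith [hx.2]⟩
    rw [measure_sdiff hsub
      measurableSet_Icc.nullMeasurableSet (by rw [Real.volume_Icc]; simp), Real.volume_Ioo, Real.volume_Icc,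
      ← ENNReal.ofReal_sub _ (by linarith), min_eq_right (by linarith)]
    congr 1; ring
  · rw [Icc_eq_empty (by linarith), sdiff_empty, Real.volume_Ioo, min_eq_left (by linarith)]

lemma summable_min {x : ℝ} (hx : 0 ≤ x) : Summable fun j => min (S.l j * x) 1 :=
  Summable.of_nonneg_of_le (fun j => le_min (mul_nonneg (S.l_pos j).le hx) zero_le_one)
    (fun _ => min_le_left _ _) (S.summable_l.mul_right x)

lemma summable_fract {x : ℝ} (hx : 0 ≤ x) : Summable fun j => Int.fract (S.l j * x) := by
  refine Summable.of_nonneg_of_le (fun j => Int.fract_nonneg _) (fun j => ?_)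
    (S.summable_l.mul_right x)
  have : (0 : ℝ) ≤ ⌊S.l j * x⌋ := by
    exact_mod_cast Int.floor_nonneg.mpr (mul_nonneg (S.l_pos j).le hx)
  rw [Int.fract]
  linarith

/-- The counting function `∑ min (l_j x) 1`, a continuous substitute for `N_L`. -/
noncomputable def minSum (x : ℝ) : ℝ := ∑' j, min (S.l j * x) 1

/-- The deficit `∑ {l_j x}` of the spectral counting function from its Weyl term. -/
noncomputable def fractSum (x : ℝ) : ℝ := ∑' j, Int.fract (S.l j * x)

lemma Nnu_eq {x : ℝ} (hx : 0 ≤ x) : S.Nnu x = S.weyl x - S.fractSum x := by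
  rw [Nnu, weyl, fractSum, ← tsum_mul_right,
    ← (S.summable_l.mul_right x).tsum_sub (S.summable_fract hx)]
  simp

lemma volume_innerNbhd {ε : ℝ} (hε : 0 < ε) :
    (volume (S.innerNbhd ε)).toReal = 2 * ε * S.minSum (2 * ε)⁻¹ := by
  have hsum : Summable fun j => min (S.l j) (2 * ε) :=
    Summable.of_nonneg_of_le (fun j => le_min (S.l_pos j).le (by linarith))
      (fun _ => min_le_left _ _) S.summable_l
  rw [innerNbhd_eq, measure_iUnion]
  · simp_rw [volume_Ioo_diff_Icc hε]
    change (∑' j, ENNReal.ofReal (min (S.l j) (2 * ε))).toReal = _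
    rw [← ENNReal.ofReal_tsum_of_nonneg _ hsum, ENNReal.toReal_ofReal, minSum, ← tsum_mul_left]
    · refine tsum_congr fun j => ?_
      rw [mul_min_of_nonneg _ _ (by linarith)]
      congr 1
      · field_simp
      · ring
    · exact tsum_nonneg fun j => le_min (S.l_pos j).le (by linarith)
    · exact fun j => le_min (S.l_pos j).le (by linarith)
  · intro i j hij
    exact (S.disj hij).mono sdiff_subset sdiff_subset
  · exact fun j => measurableSet_Ioo.diff measurableSet_Icc

lemma minkTendsto_iff {D M : ℝ} :
    S.MinkTendsto D M ↔
      Tendsto (fun x : ℝ => x ^ (-D) * S.minSum x) atTop (𝓝 (M * 2 ^ (D - 1))) := by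
  have h1 : ∀ ε ∈ Ioi (0 : ℝ), (volume (S.innerNbhd ε)).toReal / ε ^ (1 - D) =
      2 ^ (1 - D) * (((2 * ε)⁻¹ : ℝ) ^ (-D) * S.minSum (2 * ε)⁻¹) := by
    intro ε hε
    have hε : 0 < ε := hε
    rw [S.volume_innerNbhd hε, Real.inv_rpow (by positivity), Real.rpow_neg (by positivity),
      inv_inv, Real.mul_rpow (by norm_num) hε.le, Real.rpow_sub hε,
      Real.rpow_sub (zero_lt_two (α := ℝ)), Real.rpow_one, Real.rpow_one]
    have := Real.rpow_pos_of_pos hε D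
    have := Real.rpow_pos_of_pos (zero_lt_two (α := ℝ)) D
    field_simp
  have h2 : Tendsto (fun ε : ℝ => (2 * ε)⁻¹) (𝓝[>] 0) atTop := by
    refine tendsto_inv_nhdsGT_zero.comp (tendsto_nhdsWithin_iff.mpr ⟨?_, ?_⟩)
    · have : Tendsto (fun ε : ℝ => 2 * ε) (𝓝 0) (𝓝 (2 * 0)) := tendsto_id.const_mul 2
      rw [mul_zero] at this
      exact this.mono_left nhdsWithin_le_nhds
    · filter_upwards [self_mem_nhdsWithin] with ε hε
      have : (0 : ℝ) < ε := hε
      show (0 : ℝ) < 2 * ε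
      linarith
  have h3 : Tendsto (fun x : ℝ => (2 * x)⁻¹) atTop (𝓝[>] 0) :=
    tendsto_inv_atTop_nhdsGT_zero.comp (tendsto_id.const_mul_atTop zero_lt_two)
  have h4 : (2 : ℝ) ^ (D - 1) * 2 ^ (1 - D) = 1 := by
    rw [← Real.rpow_add zero_lt_two]; simp
  have h5 : S.MinkTendsto D M ↔ Tendsto (fun ε : ℝ => 2 ^ (1 - D) *
      (((2 * ε)⁻¹ : ℝ) ^ (-D) * S.minSum (2 * ε)⁻¹)) (𝓝[>] 0) (𝓝 M) := by
    refine tendsto_congr' ?_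
    filter_upwards [self_mem_nhdsWithin] with ε hε using h1 ε hε
  rw [h5]
  constructor
  · intro h
    have := (h.comp h3).const_mul (2 ^ (D - 1))
    rw [mul_comm (2 ^ (D - 1)) M] at this
    refine this.congr fun x => ?_
    have h6 : (2 * (2 * x)⁻¹)⁻¹ = x := by
      rw [mul_inv, inv_inv]; ring
    simp only [Function.comp]
    rw [← mul_assoc, h4, one_mul, h6]
  · intro h
    have := (h.comp h2).const_mul (2 ^ (1 - D))
    rw [show 2 ^ (1 - D) * (M * 2 ^ (D - 1)) = M by linear_combination M * h4] at this
    exact this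

end FractalString

lemma min_one_le_min_half_add_fract {y : ℝ} (hy : 0 ≤ y) :
    min y 1 ≤ min (y / 2) 1 + (Int.fract y + Int.fract (y / 2)) := by
  have h1 := Int.fract_nonneg y
  have h2 := Int.fract_nonneg (y / 2)
  rcases lt_or_ge y 1 with h | h
  · rw [min_eq_left h.le, min_eq_left (by linarith), Int.fract_eq_self.mpr ⟨hy, h⟩]
    linarith
  · rw [min_eq_right h]
    rcases lt_or_ge y 2 with h' | h'
    · rw [min_eq_left (by linarith),
        Int.fract_eq_self.mpr (⟨by linarith, by linarith⟩ : 0 ≤ y / 2 ∧ y / 2 < 1)]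
      linarith
    · rw [min_eq_right (by linarith)]
      linarith

namespace FractalString

variable (S : FractalString)

lemma minSum_nonneg {x : ℝ} (hx : 0 ≤ x) : 0 ≤ S.minSum x :=
  tsum_nonneg fun j => le_min (mul_nonneg (S.l_pos j).le hx) zero_le_one

lemma minSum_le_weyl {x : ℝ} (hx : 0 ≤ x) : S.minSum x ≤ S.weyl x := by
  rw [minSum, weyl, ← tsum_mul_right]
  exact (S.summable_min hx).tsum_le_tsum (fun j => min_le_left _ _) (S.summable_l.mul_right x)

lemma fractSum_le_weyl {x : ℝ} (hx : 0 ≤ x) : S.fractSum x ≤ S.weyl x := by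
  rw [fractSum, weyl, ← tsum_mul_right]
  refine (S.summable_fract hx).tsum_le_tsum (fun j => ?_) (S.summable_l.mul_right x)
  have : (0 : ℝ) ≤ ⌊S.l j * x⌋ := by
    exact_mod_cast Int.floor_nonneg.mpr (mul_nonneg (S.l_pos j).le hx)
  rw [Int.fract]
  linarith

lemma minSum_le_half_add {x : ℝ} (hx : 0 ≤ x) :
    S.minSum x ≤ S.minSum (x / 2) + (S.fractSum x + S.fractSum (x / 2)) := by
  have hx2 : 0 ≤ x / 2 := by linarith
  have h1 := S.summable_fract hx
  have h2 := S.summable_fract hx2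
  have h3 := S.summable_min hx2
  rw [minSum, minSum, fractSum, fractSum, ← h1.tsum_add h2, ← h3.tsum_add (h1.add h2)]
  refine (S.summable_min hx).tsum_le_tsum (fun j => ?_) (h3.add (h1.add h2))
  have := min_one_le_min_half_add_fract (mul_nonneg (S.l_pos j).le hx)
  rwa [mul_div_assoc] at this

lemma weyl_const_nonneg : 0 ≤ ∑' j, S.l j := tsum_nonneg fun j => (S.l_pos j).le

lemma minSum_le_of_fractSum_le {D C : ℝ} (hD : 0 < D) (hC : 0 ≤ C)
    (h : ∀ x, 0 < x → S.fractSum x ≤ C * x ^ D) {x : ℝ} (hx : 0 < x) :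
    S.minSum x ≤ 2 * C / (1 - 2 ^ (-D)) * x ^ D := by
  have hq : (2 : ℝ) ^ (-D) < 1 := Real.rpow_lt_one_of_one_lt_of_neg one_lt_two (by linarith)
  set B := 2 * C / (1 - (2 : ℝ) ^ (-D)) with hB
  have hB' : B * (1 - (2 : ℝ) ^ (-D)) = 2 * C := div_mul_cancel₀ _ (by linarith)
  have hB0 : 0 ≤ B := div_nonneg (by linarith) (by linarith)
  have key : ∀ n : ℕ, ∀ x : ℝ, 0 < x → S.minSum x ≤ B * x ^ D + S.weyl x * (1 / 2) ^ n := by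
    intro n
    induction n with
    | zero =>
      intro x hx
      have := S.minSum_le_weyl hx.le
      have : 0 ≤ B * x ^ D := by positivity
      simp only [pow_zero, mul_one]
      linarith
    | succ n ih =>
      intro x hx
      have h1 := ih (x / 2) (by linarith)
      have h2 := S.minSum_le_half_add hx.le
      have h3 := h x hx
      have h4 := h (x / 2) (by linarith)
      have h5 : (x / 2) ^ D = 2 ^ (-D) * x ^ D := by
        rw [Real.div_rpow hx.le zero_le_two, Real.rpow_neg zero_le_two]
        field_simp
      have h6 : S.weyl (x / 2) = S.weyl x * (1 / 2) := by simp only [weyl]; ring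
      rw [h5] at h1 h4
      rw [h6] at h1
      have h7 : 0 ≤ x ^ D := by positivity
      have h8 : C * (2 ^ (-D) * x ^ D) ≤ C * x ^ D := by
        gcongr
        nlinarith
      have h9 : S.weyl x * (1 / 2) ^ (n + 1) = S.weyl x * (1 / 2) * (1 / 2) ^ n := by ring
      have h10 : B * x ^ D = B * (2 ^ (-D) * x ^ D) + 2 * C * x ^ D := by
        linear_combination x ^ D * hB'
      linarith
  have hlim : Tendsto (fun n : ℕ => B * x ^ D + S.weyl x * (1 / 2) ^ n) atTop
      (𝓝 (B * x ^ D + S.weyl x * 0)) :=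
    ((tendsto_pow_atTop_nhds_zero_of_lt_one (by norm_num) (by norm_num)).const_mul _).const_add _
  rw [mul_zero, add_zero] at hlim
  exact ge_of_tendsto' hlim fun n => key n x hx

lemma minSum_mono {x y : ℝ} (hx : 0 ≤ x) (hxy : x ≤ y) : S.minSum x ≤ S.minSum y := by
  refine (S.summable_min hx).tsum_le_tsum (fun j => ?_) (S.summable_min (hx.trans hxy))
  exact min_le_min_right _ (mul_le_mul_of_nonneg_left hxy (S.l_pos j).le)

lemma minSum_mul_le {x q : ℝ} (hx : 0 ≤ x) (hq : 1 ≤ q) :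
    S.minSum (q * x) ≤ q * S.minSum x := by
  have hq0 : 0 ≤ q := by linarith
  rw [minSum, minSum, ← tsum_mul_left]
  refine (S.summable_min (mul_nonneg hq0 hx)).tsum_le_tsum (fun j => ?_)
    ((S.summable_min hx).mul_left q)
  rw [mul_min_of_nonneg _ _ hq0]
  refine min_le_min (le_of_eq (by ring)) (by linarith)

/-- `x ↦ x ^ (-D) * minSum x` is Lipschitz on the logarithmic scale once it is bounded. -/
lemma abs_exp_mul_minSum_sub_le {D B : ℝ} (hD : D ∈ Set.Ioo (0 : ℝ) 1)
    (h : ∀ u : ℝ, Real.exp (D * u) * S.minSum (Real.exp (-u)) ≤ B) (u v : ℝ) :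
    |Real.exp (D * u) * S.minSum (Real.exp (-u)) -
      Real.exp (D * v) * S.minSum (Real.exp (-v))| ≤ 2 * B * |u - v| := by
  wlog huv : u ≤ v generalizing u v
  · rw [abs_sub_comm, abs_sub_comm u v]
    exact this v u (le_of_not_ge huv)
  obtain ⟨d, hd, rfl⟩ : ∃ d, 0 ≤ d ∧ v = u + d := ⟨v - u, by linarith, by ring⟩
  set P := Real.exp (D * u) * S.minSum (Real.exp (-u)) with hP
  set Q := Real.exp (D * (u + d)) * S.minSum (Real.exp (-(u + d))) with hQ
  have hP0 : 0 ≤ P := mul_nonneg (Real.exp_pos _).le (S.minSum_nonneg (Real.exp_pos _).le)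
  have hQ0 : 0 ≤ Q := mul_nonneg (Real.exp_pos _).le (S.minSum_nonneg (Real.exp_pos _).le)
  have hPB : P ≤ B := h u
  have hQB : Q ≤ B := h (u + d)
  have h1 : Q ≤ Real.exp (D * d) * P := by
    rw [hP, hQ, ← mul_assoc, ← Real.exp_add, mul_add, add_comm (D * u)]
    gcongr
    exact S.minSum_mono (Real.exp_pos _).le (Real.exp_le_exp.mpr (by linarith))
  have h2 : P ≤ Real.exp ((1 - D) * d) * Q := by
    have h3 := S.minSum_mul_le (x := Real.exp (-(u + d))) (q := Real.exp d) (Real.exp_pos _).le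
      (Real.one_le_exp hd)
    rw [← Real.exp_add, show d + -(u + d) = -u by ring] at h3
    calc P ≤ Real.exp (D * u) * (Real.exp d * S.minSum (Real.exp (-(u + d)))) := by
          rw [hP]; gcongr
      _ = _ := by
          rw [hQ, ← mul_assoc, ← mul_assoc, ← Real.exp_add, ← Real.exp_add]
          congr 2; ring
  have habs : |u - (u + d)| = d := by rw [sub_add_cancel_left, abs_neg, abs_of_nonneg hd]
  rw [habs]
  rcases le_or_gt d 1 with hd1 | hd1
  · have h4 : ∀ r, 0 ≤ r → r ≤ 1 → Real.exp (r * d) ≤ 1 + 2 * d := by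
      intro r hr0 hr1
      have h5 : Real.exp (r * d) ≤ Real.exp d := Real.exp_le_exp.mpr (by nlinarith)
      have h6 := Real.abs_exp_sub_one_le (x := d) (by rwa [abs_of_nonneg hd])
      rw [abs_of_nonneg hd] at h6
      linarith [le_abs_self (Real.exp d - 1)]
    have h5 := h4 D hD.1.le hD.2.le
    have h6 := h4 (1 - D) (by linarith [hD.2]) (by linarith [hD.1])
    rw [abs_le]
    constructor
    · nlinarith
    · nlinarith
  · rw [abs_le]
    constructor <;> nlinarith

lemma tendsto_fractSum_of_isBigO {D c δ : ℝ} (hδ : 0 < δ)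
    (h : (fun x : ℝ => S.Nnu x - (S.weyl x - c * x ^ D)) =O[atTop] fun x : ℝ => x ^ (D - δ)) :
    Tendsto (fun x : ℝ => x ^ (-D) * S.fractSum x) atTop (𝓝 c) := by
  have h1 : Tendsto (fun x : ℝ => x ^ (-D) * (S.Nnu x - (S.weyl x - c * x ^ D))) atTop (𝓝 0) := by
    have h2 : (fun x : ℝ => x ^ (-D) * (S.Nnu x - (S.weyl x - c * x ^ D))) =O[atTop]
        fun x : ℝ => x ^ (-δ) := by
      refine ((isBigO_refl (fun x : ℝ => x ^ (-D)) atTop).mul h).congr' EventuallyEq.rfl ?_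
      filter_upwards [eventually_gt_atTop 0] with x hx
      rw [← Real.rpow_add hx]
      congr 1; ring
    exact h2.trans_tendsto (tendsto_rpow_neg_atTop hδ)
  have h3 : Tendsto (fun x : ℝ => c - x ^ (-D) * (S.Nnu x - (S.weyl x - c * x ^ D))) atTop
      (𝓝 (c - 0)) := h1.const_sub c
  rw [sub_zero] at h3
  refine h3.congr' ?_
  filter_upwards [eventually_gt_atTop 0] with x hx
  rw [S.Nnu_eq hx.le]
  have h4 : x ^ (-D) * x ^ D = 1 := by rw [← Real.rpow_add hx]; simp
  linear_combination (-c) * h4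

lemma exists_fractSum_le {D c : ℝ} (hD : D < 1)
    (h : Tendsto (fun x : ℝ => x ^ (-D) * S.fractSum x) atTop (𝓝 c)) :
    ∃ C, 0 ≤ C ∧ ∀ x, 0 < x → S.fractSum x ≤ C * x ^ D := by
  have h1 : ∀ᶠ x in atTop, x ^ (-D) * S.fractSum x ≤ c + 1 :=
    (h.eventually (eventually_le_nhds (by linarith : c < c + 1)))
  obtain ⟨x₀, hx₀⟩ := eventually_atTop.mp h1
  set X := max x₀ 1 with hX
  have hX1 : 1 ≤ X := le_max_right _ _
  have hX0 : 0 < X := by linarith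
  refine ⟨max (c + 1) ((∑' j, S.l j) * X ^ (1 - D)), le_max_of_le_right
    (mul_nonneg S.weyl_const_nonneg (by positivity)), fun x hx => ?_⟩
  have hxD : 0 < x ^ D := Real.rpow_pos_of_pos hx D
  rcases le_or_gt X x with h2 | h2
  · have h3 := hx₀ x ((le_max_left _ _).trans h2)
    rw [Real.rpow_neg hx.le, inv_mul_le_iff₀ hxD] at h3
    calc S.fractSum x ≤ (c + 1) * x ^ D := by linarith
      _ ≤ _ := by gcongr; exact le_max_left _ _
  · calc S.fractSum x ≤ S.weyl x := S.fractSum_le_weyl hx.le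
      _ = (∑' j, S.l j) * (x ^ (1 - D) * x ^ D) := by
        rw [weyl, ← Real.rpow_add hx]; simp
      _ ≤ (∑' j, S.l j) * (X ^ (1 - D) * x ^ D) := by
        have := S.weyl_const_nonneg
        gcongr
      _ ≤ _ := by
        rw [← mul_assoc]
        gcongr
        exact le_max_right _ _

end FractalString

section Tauberian

open Set Complex
open scoped FourierTransform SchwartzMap ContDiff

lemma pow_mul_exp_neg_le {δ : ℝ} (hδ : 0 < δ) (n : ℕ) {v : ℝ} (hv : 0 ≤ v) :
    v ^ n * Real.exp (-δ * v) ≤ n.factorial / δ ^ n := by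
  have h := Real.pow_div_factorial_le_exp (δ * v) (by positivity) n
  have hn : (0 : ℝ) < n.factorial := by exact_mod_cast n.factorial_pos
  rw [div_le_iff₀ hn, mul_pow] at h
  rw [neg_mul, Real.exp_neg, ← div_eq_mul_inv, div_le_div_iff₀ (Real.exp_pos _) (by positivity)]
  linarith

lemma integrable_pow_mul_of_exp_decay {f : ℝ → ℝ} (hf : Measurable f) {δ : ℝ} (hδ : 0 < δ)
    (h : ∀ u, |f u| ≤ Real.exp (-δ * |u|)) (n : ℕ) :
    Integrable fun u : ℝ => ‖u‖ ^ n * ‖(f u : ℂ)‖ := by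
  set C : ℝ := n.factorial / δ ^ n + (n + 2).factorial / δ ^ (n + 2)
  refine (integrable_inv_one_add_sq.const_mul C).mono' ?_ (Eventually.of_forall fun u => ?_)
  · exact ((measurable_norm.pow_const n).mul
      (Complex.measurable_ofReal.comp hf).norm).aestronglyMeasurable
  · rw [norm_mul, norm_pow, norm_norm, norm_norm, Complex.norm_real, Real.norm_eq_abs,
      Real.norm_eq_abs, ← div_eq_mul_inv, le_div_iff₀ (by positivity)]
    have h1 := pow_mul_exp_neg_le hδ n (abs_nonneg u)
    have h2 := pow_mul_exp_neg_le hδ (n + 2) (abs_nonneg u)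
    have h3 : |u| ^ (n + 2) = |u| ^ n * u ^ 2 := by rw [pow_add, sq_abs]
    rw [h3] at h2
    calc |u| ^ n * |f u| * (1 + u ^ 2) ≤ |u| ^ n * Real.exp (-δ * |u|) * (1 + u ^ 2) := by
          gcongr; exact h u
      _ = |u| ^ n * Real.exp (-δ * |u|) + |u| ^ n * u ^ 2 * Real.exp (-δ * |u|) := by ring
      _ ≤ C := add_le_add h1 h2

lemma integrable_of_exp_decay {f : ℝ → ℝ} (hf : Measurable f) {δ : ℝ} (hδ : 0 < δ)
    (h : ∀ u, |f u| ≤ Real.exp (-δ * |u|)) : Integrable fun u => (f u : ℂ) := by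
  have := integrable_pow_mul_of_exp_decay hf hδ h 0
  simp only [pow_zero, one_mul] at this
  exact (integrable_norm_iff (Complex.measurable_ofReal.comp hf).aestronglyMeasurable).mp this

lemma contDiff_fourier_of_exp_decay {f : ℝ → ℝ} (hf : Measurable f) {δ : ℝ} (hδ : 0 < δ)
    (h : ∀ u, |f u| ≤ Real.exp (-δ * |u|)) : ContDiff ℝ ∞ (𝓕 fun u => (f u : ℂ)) :=
  Real.contDiff_fourier (N := ⊤) fun n _ => integrable_pow_mul_of_exp_decay hf hδ h n

/-- Correlating with the Fourier transform of `θ` amounts to a twisted pairing of Fourier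
transforms. -/
lemma integral_mul_fourier_sub {f : ℝ → ℂ} (hf : Integrable f) (θ : 𝓢(ℝ, ℂ)) (t : ℝ) :
    ∫ u, f u * 𝓕 (θ : ℝ → ℂ) (u - t) =
      ∫ ξ, 𝓕 f ξ * ((Real.fourierChar (ξ * t) : ℂ) * θ ξ) := by
  have h1 := VectorFourier.integral_fourierIntegral_smul_eq_flip (L := innerₗ ℝ) (μ := volume)
    (ν := volume) (f := f) (g := fun ξ : ℝ => (Real.fourierChar (ξ * t) : ℂ) * θ ξ)
    Real.continuous_fourierChar continuous_inner hf ?_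
  · simp only [smul_eq_mul] at h1
    change ∫ ξ, 𝓕 f ξ * _ = _ at h1
    rw [h1]
    congr 1
    ext u
    congr 1
    rw [Real.fourier_real_eq, VectorFourier.fourierIntegral]
    congr 1
    ext ξ
    simp only [Circle.smul_def, smul_eq_mul, ← mul_assoc, ← Circle.coe_mul, ← AddChar.map_add_eq_mul]
    congr 3
    simp
    ring
  · refine (integrable_norm_iff ?_).mp ?_
    · apply Continuous.aestronglyMeasurable
      have := Real.continuous_fourierChar
      have := θ.continuous
      fun_prop
    · simpa [norm_mul, Circle.norm_coe] using (θ.integrable (μ := volume)).norm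

lemma integral_fourier_schwartz (θ : 𝓢(ℝ, ℂ)) : ∫ u, 𝓕 (θ : ℝ → ℂ) u = θ 0 := by
  have h1 : 𝓕⁻ (𝓕 θ) = θ := FourierTransform.fourierInv_fourier_eq θ
  have h2 := congrArg (fun f : 𝓢(ℝ, ℂ) => f 0) h1
  simp only [SchwartzMap.fourierInv_coe, SchwartzMap.fourier_coe] at h2
  rw [← h2, Real.fourierInv_eq']
  simp

lemma measurable_tsum_of_nonneg {f : ℕ → ℝ → ℝ} (hf : ∀ j, Measurable (f j))
    (hs : ∀ u, Summable fun j => f j u) : Measurable fun u => ∑' j, f j u :=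
  measurable_of_tendsto_metrizable (fun n => Finset.measurable_sum (Finset.range n) fun j _ => hf j)
    (tendsto_pi_nhds.mpr fun u => by simpa using (hs u).hasSum.tendsto_sum_nat)

lemma integral_tsum_mul {f : ℕ → ℝ → ℝ} (hf : ∀ j, Measurable (f j)) (h0 : ∀ j u, 0 ≤ f j u)
    (hs : ∀ u, Summable fun j => f j u) {C : ℝ} (hC : ∀ u, ∑' j, f j u ≤ C)
    {k : ℝ → ℂ} (hk : Integrable k) :
    ∫ u, ((∑' j, f j u : ℝ) : ℂ) * k u = ∑' j, ∫ u, ((f j u : ℝ) : ℂ) * k u := by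
  have hm : ∀ j, AEStronglyMeasurable (fun u => ((f j u : ℝ) : ℂ) * k u) volume := fun j =>
    (Complex.measurable_ofReal.comp (hf j)).aestronglyMeasurable.mul hk.1
  rw [← integral_tsum hm]
  · congr 1
    ext u
    rw [ofReal_tsum, tsum_mul_right]
  · rw [← lintegral_tsum fun j => (hm j).enorm]
    have h1 : ∀ u, ∑' j, ‖((f j u : ℝ) : ℂ) * k u‖ₑ ≤ ENNReal.ofReal C * ‖k u‖ₑ := by
      intro u
      have h2 : ∀ j, ‖((f j u : ℝ) : ℂ) * k u‖ₑ = ENNReal.ofReal (f j u) * ‖k u‖ₑ := by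
        intro j
        rw [enorm_mul, ← ofReal_norm, Complex.norm_real, Real.norm_of_nonneg (h0 j u)]
      simp_rw [h2]
      rw [ENNReal.tsum_mul_right, ← ENNReal.ofReal_tsum_of_nonneg (fun j => h0 j u) (hs u)]
      gcongr
      exact hC u
    refine ne_of_lt ((lintegral_mono h1).trans_lt ?_)
    rw [lintegral_const_mul' _ _ ENNReal.ofReal_ne_top]
    exact ENNReal.mul_lt_top ENNReal.ofReal_lt_top hk.2

/-- A nonnegative measurable kernel together with weights and translations whose superposition is
a bounded function. -/
structure IsBoundedSuperposition (w a : ℕ → ℝ) (h : ℝ → ℝ) (δ C : ℝ) : Prop where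
  measurable : Measurable h
  nonneg : ∀ u, 0 ≤ h u
  decay_pos : 0 < δ
  decay : ∀ u, |h u| ≤ Real.exp (-δ * |u|)
  weight_nonneg : ∀ j, 0 ≤ w j
  summable : ∀ u, Summable fun j => w j * h (u - a j)
  bound : ∀ u, ∑' j, w j * h (u - a j) ≤ C

namespace IsBoundedSuperposition

variable {w a : ℕ → ℝ} {h g : ℝ → ℝ} {δ C B : ℝ}

lemma measurable_term (H : IsBoundedSuperposition w a h δ C) (j : ℕ) :
    Measurable fun u => w j * h (u - a j) :=
  (H.measurable.comp (measurable_id.sub_const _)).const_mul _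

lemma measurable_sum (H : IsBoundedSuperposition w a h δ C) :
    Measurable fun u => ∑' j, w j * h (u - a j) :=
  measurable_tsum_of_nonneg H.measurable_term H.summable

lemma sum_nonneg (H : IsBoundedSuperposition w a h δ C) (u : ℝ) :
    0 ≤ ∑' j, w j * h (u - a j) :=
  tsum_nonneg fun j => mul_nonneg (H.weight_nonneg j) (H.nonneg _)

lemma norm_sum_le (H : IsBoundedSuperposition w a h δ C) (u : ℝ) :
    ‖((∑' j, w j * h (u - a j) : ℝ) : ℂ)‖ ≤ C := by
  rw [Complex.norm_real, Real.norm_of_nonneg (H.sum_nonneg u)]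
  exact H.bound u

lemma integrable (H : IsBoundedSuperposition w a h δ C) : Integrable fun u => (h u : ℂ) :=
  integrable_of_exp_decay H.measurable H.decay_pos H.decay

lemma integral_sum_mul_fourier (H : IsBoundedSuperposition w a h δ C) (θ : 𝓢(ℝ, ℂ)) (t : ℝ) :
    ∫ u, ((∑' j, w j * h (u - a j) : ℝ) : ℂ) * 𝓕 (θ : ℝ → ℂ) (u - t) =
      ∑' j, (w j : ℂ) * ∫ ξ, (Real.fourierChar (ξ * (t - a j)) : ℂ) *
        (𝓕 (fun u => (h u : ℂ)) ξ * θ ξ) := by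
  have hθ : Integrable (𝓕 (θ : ℝ → ℂ)) := (𝓕 θ).integrable
  rw [integral_tsum_mul H.measurable_term
    (fun j u => mul_nonneg (H.weight_nonneg j) (H.nonneg _)) H.summable H.bound
    (hθ.comp_sub_right t)]
  refine tsum_congr fun j => ?_
  have h1 : ∫ u, ((w j * h (u - a j) : ℝ) : ℂ) * 𝓕 (θ : ℝ → ℂ) (u - t) =
      ∫ u, (w j : ℂ) * ((h u : ℂ) * 𝓕 (θ : ℝ → ℂ) (u - (t - a j))) := by
    rw [← integral_sub_right_eq_self
      (fun u => (w j : ℂ) * ((h u : ℂ) * 𝓕 (θ : ℝ → ℂ) (u - (t - a j)))) (a j)]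
    congr 1
    ext u
    rw [sub_sub_sub_cancel_right]
    push_cast
    ring
  rw [h1, integral_const_mul, integral_mul_fourier_sub H.integrable]
  congr 2
  ext ξ
  ring

lemma tendsto_integral (H : IsBoundedSuperposition w a h δ C) {c : ℝ}
    (hc : Tendsto (fun u => ∑' j, w j * h (u - a j)) atBot (𝓝 c)) (θ : 𝓢(ℝ, ℂ)) :
    Tendsto (fun t => ∫ u, ((∑' j, w j * h (u - a j) : ℝ) : ℂ) * 𝓕 (θ : ℝ → ℂ) (u - t)) atBot
      (𝓝 (c * θ 0)) := by
  have hθ : Integrable (𝓕 (θ : ℝ → ℂ)) := (𝓕 θ).integrable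
  rw [← integral_fourier_schwartz θ, ← integral_const_mul]
  have h1 : ∀ t, ∫ u, ((∑' j, w j * h (u - a j) : ℝ) : ℂ) * 𝓕 (θ : ℝ → ℂ) (u - t) =
      ∫ u, ((∑' j, w j * h (u + t - a j) : ℝ) : ℂ) * 𝓕 (θ : ℝ → ℂ) u := by
    intro t
    rw [← integral_add_right_eq_self _ t]
    simp
  simp_rw [h1]
  refine tendsto_integral_filter_of_dominated_convergence (fun u => C * ‖𝓕 (θ : ℝ → ℂ) u‖) ?_ ?_
    (hθ.norm.const_mul C) ?_
  · refine Eventually.of_forall fun t => ?_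
    exact (Complex.measurable_ofReal.comp
      (H.measurable_sum.comp (measurable_id.add_const t))).aestronglyMeasurable.mul hθ.1
  · refine Eventually.of_forall fun t => Eventually.of_forall fun u => ?_
    rw [norm_mul]
    gcongr
    exact H.norm_sum_le _
  · refine Eventually.of_forall fun u => ?_
    refine Tendsto.mul_const _ ?_
    refine (Complex.continuous_ofReal.tendsto c).comp (hc.comp ?_)
    exact tendsto_atBot_add_const_left _ u tendsto_id

lemma norm_sub_integral_le (H : IsBoundedSuperposition w a h δ C) {L : ℝ}
    (hL : ∀ u v, |(∑' j, w j * h (u - a j)) - ∑' j, w j * h (v - a j)| ≤ L * |u - v|)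
    (θ : 𝓢(ℝ, ℂ)) (t : ℝ) :
    ‖((∑' j, w j * h (t - a j) : ℝ) : ℂ) * θ 0 -
      ∫ u, ((∑' j, w j * h (u - a j) : ℝ) : ℂ) * 𝓕 (θ : ℝ → ℂ) (u - t)‖ ≤
      L * ∫ u, |u| * ‖𝓕 (θ : ℝ → ℂ) u‖ := by
  have hθ : Integrable (𝓕 (θ : ℝ → ℂ)) := (𝓕 θ).integrable
  have hθ1 : Integrable fun u => |u| * ‖𝓕 (θ : ℝ → ℂ) u‖ := by
    have := (𝓕 θ).integrable_pow_mul volume 1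
    simp only [pow_one, Real.norm_eq_abs] at this
    exact this
  have h1 : ∫ u, ((∑' j, w j * h (u - a j) : ℝ) : ℂ) * 𝓕 (θ : ℝ → ℂ) (u - t) =
      ∫ u, ((∑' j, w j * h (u + t - a j) : ℝ) : ℂ) * 𝓕 (θ : ℝ → ℂ) u := by
    rw [← integral_add_right_eq_self _ t]
    simp
  have h2 : Integrable fun u => ((∑' j, w j * h (u + t - a j) : ℝ) : ℂ) * 𝓕 (θ : ℝ → ℂ) u :=
    hθ.bdd_mul (Complex.measurable_ofReal.comp
      (H.measurable_sum.comp (measurable_id.add_const t))).aestronglyMeasurable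
      (Eventually.of_forall fun u => H.norm_sum_le _)
  rw [h1, ← integral_fourier_schwartz θ, ← integral_const_mul,
    ← integral_sub (hθ.const_mul _) h2, ← integral_const_mul]
  refine norm_integral_le_of_norm_le (hθ1.const_mul L) (Eventually.of_forall fun u => ?_)
  rw [← sub_mul, norm_mul, ← mul_assoc, ← ofReal_sub, Complex.norm_real, Real.norm_eq_abs]
  gcongr
  have := hL t (u + t)
  rwa [show t - (u + t) = -u by ring, abs_neg] at this

end IsBoundedSuperposition

/-- A smooth compactly supported function equal to `1` at the origin, dilated by `r`. -/
noncomputable def dilatedBump (r : ℝ) : ℝ → ℂ :=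
  fun ξ => ((default : ContDiffBump (0 : ℝ)) (r⁻¹ * ξ) : ℂ)

lemma contDiff_dilatedBump (r : ℝ) : ContDiff ℝ ∞ (dilatedBump r) :=
  Complex.ofRealCLM.contDiff.comp
    ((default : ContDiffBump (0 : ℝ)).contDiff.comp (contDiff_const.mul contDiff_id))

lemma hasCompactSupport_dilatedBump {r : ℝ} (hr : r ≠ 0) : HasCompactSupport (dilatedBump r) :=
  ((default : ContDiffBump (0 : ℝ)).hasCompactSupport.comp_smul (inv_ne_zero hr)).comp_left
    (g := ((↑) : ℝ → ℂ)) Complex.ofReal_zero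

lemma dilatedBump_zero (r : ℝ) : dilatedBump r 0 = 1 := by
  have := (default : ContDiffBump (0 : ℝ)).one_of_mem_closedBall
    (Metric.mem_closedBall_self (default : ContDiffBump (0 : ℝ)).rIn_pos.le)
  simp [dilatedBump, this]

lemma fourier_dilatedBump {r : ℝ} (hr : 0 < r) (u : ℝ) :
    𝓕 (dilatedBump r) u = r * 𝓕 (dilatedBump 1) (r * u) := by
  rw [Real.fourier_real_eq, Real.fourier_real_eq]
  have := Measure.integral_comp_mul_left
    (fun v : ℝ => Real.fourierChar (-(v * (r * u))) • dilatedBump 1 v) r⁻¹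
  rw [inv_inv, abs_of_pos hr] at this
  rw [← Complex.real_smul, ← this]
  congr 1
  ext v
  have h1 : r⁻¹ * v * (r * u) = v * u := by field_simp
  simp [dilatedBump, h1]

lemma integral_abs_mul_norm_fourier_dilatedBump {r : ℝ} (hr : 0 < r) :
    ∫ u, |u| * ‖𝓕 (dilatedBump r) u‖ = r⁻¹ * ∫ u, |u| * ‖𝓕 (dilatedBump 1) u‖ := by
  have := Measure.integral_comp_mul_left (fun u : ℝ => |u| * ‖𝓕 (dilatedBump 1) u‖) r
  rw [abs_of_pos (inv_pos.mpr hr), smul_eq_mul] at this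
  rw [← this]
  congr 1
  ext u
  rw [fourier_dilatedBump hr, norm_mul, abs_mul, Complex.norm_real, Real.norm_eq_abs,
    abs_of_pos hr]
  ring

/-- A form of Wiener's Tauberian theorem: if the Fourier transform of `h` has no zeros, a limit of
a superposition of translates of `h` passes to the same superposition of translates of `g`,
provided the latter is Lipschitz. -/
theorem tendsto_superposition_of_fourier_ne_zero {w a : ℕ → ℝ} {h g : ℝ → ℝ} {δ C δ' B c L : ℝ}
    (H : IsBoundedSuperposition w a h δ C) (G : IsBoundedSuperposition w a g δ' B)
    (hne : ∀ ξ, 𝓕 (fun u => (h u : ℂ)) ξ ≠ 0)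
    (hc : Tendsto (fun u => ∑' j, w j * h (u - a j)) atBot (𝓝 c))
    (hL : ∀ u v, |(∑' j, w j * g (u - a j)) - ∑' j, w j * g (v - a j)| ≤ L * |u - v|) :
    Tendsto (fun u => ((∑' j, w j * g (u - a j) : ℝ) : ℂ)) atBot
      (𝓝 (c * (𝓕 (fun u => (g u : ℂ)) 0 / 𝓕 (fun u => (h u : ℂ)) 0))) := by
  set A : ℂ := c * (𝓕 (fun u => (g u : ℂ)) 0 / 𝓕 (fun u => (h u : ℂ)) 0)
  set M := ∫ u, |u| * ‖𝓕 (dilatedBump 1) u‖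
  rw [Metric.tendsto_nhds]
  intro ε hε
  obtain ⟨r, hr0, hr⟩ : ∃ r : ℝ, 0 < r ∧ L * (r⁻¹ * M) < ε / 2 := by
    have : Tendsto (fun r : ℝ => L * (r⁻¹ * M)) atTop (𝓝 (L * (0 * M))) :=
      (tendsto_inv_atTop_zero.mul_const M).const_mul L
    rw [zero_mul, mul_zero] at this
    exact ((eventually_gt_atTop 0).and (this.eventually_lt_const (half_pos hε))).exists
  set ψ : 𝓢(ℝ, ℂ) := (hasCompactSupport_dilatedBump hr0.ne').toSchwartzMap (contDiff_dilatedBump r)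
  have hψ : (ψ : ℝ → ℂ) = dilatedBump r := rfl
  have hquot : ContDiff ℝ ∞ fun ξ => dilatedBump r ξ *
      (𝓕 (fun u => (g u : ℂ)) ξ / 𝓕 (fun u => (h u : ℂ)) ξ) :=
    (contDiff_dilatedBump r).mul
      ((contDiff_fourier_of_exp_decay G.measurable G.decay_pos G.decay).mul
        ((contDiff_fourier_of_exp_decay H.measurable H.decay_pos H.decay).inv hne))
  set θ : 𝓢(ℝ, ℂ) := ((hasCompactSupport_dilatedBump hr0.ne').mul_right).toSchwartzMap hquot
  have hθ : ∀ ξ, θ ξ = dilatedBump r ξ *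
      (𝓕 (fun u => (g u : ℂ)) ξ / 𝓕 (fun u => (h u : ℂ)) ξ) := fun ξ => rfl
  have htransfer : ∀ t, ∫ u, ((∑' j, w j * h (u - a j) : ℝ) : ℂ) * 𝓕 (θ : ℝ → ℂ) (u - t) =
      ∫ u, ((∑' j, w j * g (u - a j) : ℝ) : ℂ) * 𝓕 (ψ : ℝ → ℂ) (u - t) := by
    intro t
    rw [H.integral_sum_mul_fourier, G.integral_sum_mul_fourier]
    refine tsum_congr fun j => ?_
    congr 2
    ext ξ
    congr 1
    rw [hθ, hψ]
    field_simp [hne ξ]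
  have hlim := H.tendsto_integral hc θ
  simp_rw [htransfer] at hlim
  have hA : (c : ℂ) * θ 0 = A := by rw [hθ, dilatedBump_zero, one_mul]
  rw [hA] at hlim
  filter_upwards [Metric.tendsto_nhds.mp hlim (ε / 2) (half_pos hε)] with t ht
  have happ := G.norm_sub_integral_le hL ψ t
  rw [hψ, dilatedBump_zero, mul_one, integral_abs_mul_norm_fourier_dilatedBump hr0,
    ← dist_eq_norm] at happ
  calc _ ≤ _ := dist_triangle _ _ _
    _ < ε / 2 + ε / 2 := add_lt_add (happ.trans_lt hr) ht
    _ = ε := add_halves ε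

end Tauberian

lemma fract_le_min {y : ℝ} (hy : 0 < y) : Int.fract y ≤ min y 1 := by
  have : (0 : ℝ) ≤ ⌊y⌋ := by exact_mod_cast Int.floor_nonneg.mpr hy.le
  exact le_min (by rw [← Int.self_sub_floor]; linarith) (Int.fract_lt_one y).le

/-- The function `f` in the multiplicative variable `exp (-u)`, weighted by `exp (D * u)`. -/
noncomputable def logKernel (D : ℝ) (f : ℝ → ℝ) (u : ℝ) : ℝ := Real.exp (D * u) * f (Real.exp (-u))

lemma logKernel_nonneg {D : ℝ} {f : ℝ → ℝ} (h0 : ∀ y, 0 < y → 0 ≤ f y) (u : ℝ) :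
    0 ≤ logKernel D f u :=
  mul_nonneg (Real.exp_nonneg _) (h0 _ (Real.exp_pos _))

lemma measurable_logKernel {D : ℝ} {f : ℝ → ℝ} (hf : Measurable f) : Measurable (logKernel D f) := by
  unfold logKernel
  fun_prop

lemma abs_logKernel_le {D : ℝ} {f : ℝ → ℝ} (h0 : ∀ y, 0 < y → 0 ≤ f y)
    (h1 : ∀ y, 0 < y → f y ≤ min y 1) (u : ℝ) :
    |logKernel D f u| ≤ Real.exp (-min D (1 - D) * |u|) := by
  rw [abs_of_nonneg (logKernel_nonneg h0 u), logKernel]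
  have h := h1 _ (Real.exp_pos (-u))
  rcases le_total 0 u with hu | hu
  · calc Real.exp (D * u) * f (Real.exp (-u)) ≤ Real.exp (D * u) * Real.exp (-u) := by
          gcongr; exact h.trans (min_le_left _ _)
      _ = Real.exp (-(1 - D) * |u|) := by rw [← Real.exp_add, abs_of_nonneg hu]; ring_nf
      _ ≤ _ := by gcongr; exact min_le_right _ _
  · calc Real.exp (D * u) * f (Real.exp (-u)) ≤ Real.exp (D * u) * 1 := by
          gcongr; exact h.trans (min_le_right _ _)
      _ = Real.exp (-D * |u|) := by rw [abs_of_nonpos hu]; ring_nf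
      _ ≤ _ := by gcongr; exact min_le_left _ _

lemma rpow_mul_logKernel_sub_log {D l : ℝ} (hl : 0 < l) (f : ℝ → ℝ) (u : ℝ) :
    l ^ D * logKernel D f (u - Real.log l) = Real.exp (D * u) * f (l * Real.exp (-u)) := by
  have h1 : Real.exp (-(u - Real.log l)) = l * Real.exp (-u) := by
    rw [neg_sub, sub_eq_add_neg, Real.exp_add, Real.exp_log hl]
  have h2 : l ^ D * Real.exp (D * (u - Real.log l)) = Real.exp (D * u) := by
    rw [Real.rpow_def_of_pos hl, ← Real.exp_add]
    ring_nf
  rw [logKernel, h1, ← mul_assoc, h2]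

open scoped FourierTransform in
lemma fourier_logKernel (D : ℝ) (f : ℝ → ℝ) (ξ : ℝ) :
    𝓕 (fun u => (logKernel D f u : ℂ)) ξ =
      mellin (fun t => (f t : ℂ)) (-(D + (-(2 * Real.pi * ξ) : ℝ) * Complex.I)) := by
  rw [mellin_eq_fourier]
  have h1 : (-((D : ℂ) + (-(2 * Real.pi * ξ) : ℝ) * Complex.I)).re = -D := by simp
  have h2 : (-((D : ℂ) + (-(2 * Real.pi * ξ) : ℝ) * Complex.I)).im / (2 * Real.pi) = ξ := by
    simp only [Complex.neg_im, Complex.add_im, Complex.ofReal_im, Complex.im_ofReal_mul,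
      Complex.I_im]
    field_simp
    ring
  rw [h1, h2]
  refine congrArg (fun F : ℝ → ℂ => 𝓕 F ξ) (funext fun u => ?_)
  simp [logKernel]

lemma integral_logKernel_nonneg {D : ℝ} {f : ℝ → ℝ} (h0 : ∀ y, 0 < y → 0 ≤ f y) :
    ∫ u, (logKernel D f u : ℂ) = ((∫ u, logKernel D f u : ℝ) : ℂ) ∧ 0 ≤ ∫ u, logKernel D f u :=
  ⟨integral_ofReal, integral_nonneg fun u => logKernel_nonneg h0 u⟩

namespace FractalString

variable (S : FractalString)

lemma tsum_rpow_mul_logKernel (D : ℝ) (f : ℝ → ℝ) (u : ℝ) :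
    ∑' j, S.l j ^ D * logKernel D f (u - Real.log (S.l j)) =
      Real.exp (D * u) * ∑' j, f (S.l j * Real.exp (-u)) := by
  rw [← tsum_mul_left]
  exact tsum_congr fun j => rpow_mul_logKernel_sub_log (S.l_pos j) f u

lemma exp_mul_le_of_le_mul_rpow {D C : ℝ} {F : ℝ → ℝ} (h : ∀ x, 0 < x → F x ≤ C * x ^ D) (u : ℝ) :
    Real.exp (D * u) * F (Real.exp (-u)) ≤ C := by
  have h1 := h _ (Real.exp_pos (-u))
  rw [← Real.exp_mul] at h1
  calc Real.exp (D * u) * F (Real.exp (-u)) ≤ Real.exp (D * u) * (C * Real.exp (-u * D)) := by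
        gcongr
    _ = C * (Real.exp (D * u) * Real.exp (-u * D)) := by ring
    _ = C := by rw [← Real.exp_add, show D * u + -u * D = 0 by ring, Real.exp_zero, mul_one]

lemma isBoundedSuperposition {D C : ℝ} (hD : D ∈ Set.Ioo (0 : ℝ) 1) {f : ℝ → ℝ}
    (hf : Measurable f) (h0 : ∀ y, 0 < y → 0 ≤ f y) (h1 : ∀ y, 0 < y → f y ≤ min y 1)
    (hC : ∀ x, 0 < x → ∑' j, f (S.l j * x) ≤ C * x ^ D) :
    IsBoundedSuperposition (fun j => S.l j ^ D) (fun j => Real.log (S.l j)) (logKernel D f)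
      (min D (1 - D)) C where
  measurable := measurable_logKernel hf
  nonneg := logKernel_nonneg h0
  decay_pos := lt_min hD.1 (sub_pos.mpr hD.2)
  decay := abs_logKernel_le h0 h1
  weight_nonneg j := (Real.rpow_pos_of_pos (S.l_pos j) D).le
  summable u := by
    simp_rw [rpow_mul_logKernel_sub_log (S.l_pos _)]
    refine Summable.mul_left _ (Summable.of_nonneg_of_le (fun j => h0 _ ?_) (fun j => h1 _ ?_)
      (S.summable_min (Real.exp_nonneg (-u))))
    all_goals exact mul_pos (S.l_pos j) (Real.exp_pos _)
  bound u := by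
    rw [tsum_rpow_mul_logKernel]
    exact exp_mul_le_of_le_mul_rpow hC u

/-- If `ζ` has no zeros on `Re s = D`, the inverse spectral problem is solvable. -/
theorem minkowskiMeasurable_of_riemannZeta_ne_zero {D c δ : ℝ} (hD : D ∈ Set.Ioo (0 : ℝ) 1)
    (hζ : ∀ τ : ℝ, riemannZeta (D + τ * Complex.I) ≠ 0) (hc : 0 < c) (hδ : 0 < δ)
    (h : (fun x : ℝ => S.Nnu x - (S.weyl x - c * x ^ D)) =O[atTop] fun x : ℝ => x ^ (D - δ)) :
    S.MinkowskiMeasurable D := by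
  have hlim := S.tendsto_fractSum_of_isBigO hδ h
  obtain ⟨C, hC0, hC⟩ := S.exists_fractSum_le hD.2 hlim
  set B := 2 * C / (1 - 2 ^ (-D))
  have hB : ∀ x, 0 < x → S.minSum x ≤ B * x ^ D := fun x hx =>
    S.minSum_le_of_fractSum_le hD.1 hC0 hC hx
  have hf0 : ∀ y : ℝ, 0 < y → 0 ≤ Int.fract y := fun y _ => Int.fract_nonneg y
  have hg0 : ∀ y : ℝ, 0 < y → 0 ≤ min y 1 := fun y hy => le_min hy.le zero_le_one
  have H := S.isBoundedSuperposition hD measurable_fract hf0 (fun _ hy => fract_le_min hy) hC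
  have G := S.isBoundedSuperposition (f := fun y => min y 1) hD (measurable_id.min measurable_const) hg0
    (fun y _ => le_rfl) hB
  have hre : ∀ τ : ℝ, ((D : ℂ) + τ * Complex.I).re = D := fun τ => by simp
  have hne : ∀ τ : ℝ, (D : ℂ) + τ * Complex.I ≠ 0 := fun τ h0 => by
    have := congrArg Complex.re h0
    rw [hre] at this
    exact hD.1.ne' this
  have hfourier : ∀ ξ, FourierTransform.fourier (fun u => (logKernel D Int.fract u : ℂ)) ξ ≠ 0 := by
    intro ξ
    rw [fourier_logKernel, (hasMellin_fract (by rw [hre]; exact hD.1) (by rw [hre]; exact hD.2)).2]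
    exact div_ne_zero (neg_ne_zero.mpr (hζ _)) (hne _)
  have hconv : Tendsto (fun u => ∑' j, S.l j ^ D * logKernel D Int.fract (u - Real.log (S.l j)))
      atBot (𝓝 c) := by
    simp_rw [tsum_rpow_mul_logKernel]
    refine (hlim.comp (Real.tendsto_exp_atTop.comp tendsto_neg_atBot_atTop)).congr fun u => ?_
    simp only [Function.comp_apply]
    rw [← Real.exp_mul, neg_mul_neg, mul_comm u D]
    rfl
  have hlip : ∀ u v, |(∑' j, S.l j ^ D * logKernel D (fun y => min y 1) (u - Real.log (S.l j))) -
      ∑' j, S.l j ^ D * logKernel D (fun y => min y 1) (v - Real.log (S.l j))| ≤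
      2 * B * |u - v| := by
    intro u v
    rw [tsum_rpow_mul_logKernel, tsum_rpow_mul_logKernel]
    exact S.abs_exp_mul_minSum_sub_le hD (exp_mul_le_of_le_mul_rpow hB) u v
  have hmain := tendsto_superposition_of_fourier_ne_zero H G hfourier hconv hlip
  have hf00 := hfourier 0
  have hg00 : FourierTransform.fourier (fun u => (logKernel D (fun y => min y 1) u : ℂ)) 0 ≠ 0 := by
    rw [fourier_logKernel, (hasMellin_min (by rw [hre]; exact hD.1) (by rw [hre]; exact hD.2)).2]
    refine one_div_ne_zero (mul_ne_zero (hne _) fun h0 => ?_)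
    have := congrArg Complex.re h0
    rw [Complex.sub_re, hre] at this
    exact (sub_pos.mpr hD.2).ne' this
  have hzero : ∀ f : ℝ → ℂ, FourierTransform.fourier f (0 : ℝ) = ∫ u, f u := fun f => by
    rw [Real.fourier_real_eq]; simp
  rw [hzero, (integral_logKernel_nonneg hf0).1] at hf00
  rw [hzero, (integral_logKernel_nonneg hg0).1] at hg00
  rw [hzero, hzero, (integral_logKernel_nonneg hf0).1,
    (integral_logKernel_nonneg hg0).1] at hmain
  set p := ∫ u, logKernel D Int.fract u
  set q := ∫ u, logKernel D (fun y => min y 1) u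
  have hp : 0 < p := lt_of_le_of_ne (integral_logKernel_nonneg hf0).2 fun h => hf00 (by simp [← h])
  have hq : 0 < q := lt_of_le_of_ne (integral_logKernel_nonneg hg0).2 fun h => hg00 (by simp [← h])
  have hreal := (Complex.continuous_re.tendsto _).comp hmain
  rw [← Complex.ofReal_div, ← Complex.ofReal_mul, Complex.ofReal_re] at hreal
  refine ⟨c * (q / p) / 2 ^ (D - 1), by positivity, S.minkTendsto_iff.mpr ?_⟩
  rw [div_mul_cancel₀ _ (by positivity)]
  refine ((hreal.comp (tendsto_neg_atTop_atBot.comp Real.tendsto_log_atTop)).congr' ?_)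
  filter_upwards [eventually_gt_atTop 0] with x hx
  simp only [Function.comp_apply, Complex.ofReal_re]
  rw [tsum_rpow_mul_logKernel, neg_neg, Real.exp_log hx, Real.rpow_def_of_pos hx]
  congr 2
  ring

end FractalString

section SumIntegral

open Set

/-- For a nonnegative antitone function, integral and sum over a half-line differ by at most the
initial value. -/
lemma AntitoneOn.summable_and_integral_sub_tsum_mem {f : ℝ → ℝ} {a : ℝ} (hf : AntitoneOn f (Ici a))
    (h0 : ∀ t ∈ Ici a, 0 ≤ f t) (hi : IntegrableOn f (Ioi a)) :
    Summable (fun n : ℕ => f (a + (n + 1 : ℕ))) ∧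
      (∫ t in Ioi a, f t) - ∑' n : ℕ, f (a + (n + 1 : ℕ)) ∈ Icc 0 (f a) := by
  have hn0 : ∀ n : ℕ, 0 ≤ f (a + n) := fun n =>
    h0 _ (mem_Ici.mpr (le_add_of_nonneg_right n.cast_nonneg))
  have hlim : Tendsto (fun n : ℕ => ∫ t in a..a + n, f t) atTop (𝓝 (∫ t in Ioi a, f t)) :=
    intervalIntegral_tendsto_integral_Ioi a hi
      (tendsto_atTop_add_const_left _ a tendsto_natCast_atTop_atTop)
  have hanti : ∀ n : ℕ, AntitoneOn f (Icc a (a + n)) := fun n => hf.mono Icc_subset_Ici_self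
  have hle : ∀ n : ℕ, ∑ i ∈ Finset.range n, f (a + (i + 1 : ℕ)) ≤ ∫ t in a..a + n, f t :=
    fun n => (hanti n).sum_le_integral
  have hge : ∀ n : ℕ, ∫ t in a..a + n, f t ≤ ∑ i ∈ Finset.range n, f (a + i) :=
    fun n => (hanti n).integral_le_sum
  have hInt : ∀ n : ℕ, ∫ t in a..a + n, f t ≤ ∫ t in Ioi a, f t := fun n => by
    rw [intervalIntegral.integral_of_le (le_add_of_nonneg_right n.cast_nonneg)]
    refine setIntegral_mono_set hi ?_ Ioc_subset_Ioi_self.eventuallyLE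
    exact (ae_restrict_iff' measurableSet_Ioi).mpr
      (Eventually.of_forall fun t ht => h0 t (mem_Ici_of_Ioi ht))
  have hs : Summable fun n : ℕ => f (a + (n + 1 : ℕ)) :=
    summable_of_sum_range_le (fun n => hn0 (n + 1)) fun n => (hle n).trans (hInt n)
  refine ⟨hs, sub_nonneg.mpr ?_, sub_le_iff_le_add'.mpr ?_⟩
  · exact hs.tsum_le_of_sum_range_le fun n => (hle n).trans (hInt n)
  · refine le_of_tendsto hlim (Eventually.of_forall fun n => (hge n).trans ?_)
    calc ∑ i ∈ Finset.range n, f (a + i) ≤ ∑ i ∈ Finset.range (n + 1), f (a + i) :=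
          Finset.sum_le_sum_of_subset_of_nonneg (Finset.range_mono n.le_succ) fun i _ _ => hn0 i
      _ = (∑ i ∈ Finset.range n, f (a + (i + 1 : ℕ))) + f a := by
          rw [Finset.sum_range_succ', Nat.cast_zero, add_zero]
      _ ≤ _ := by
          gcongr
          exact hs.sum_le_tsum _ fun i _ => hn0 (i + 1)

/-- Sum versus integral for a function with values in `[0, 1]` which is, from `J` on, a difference
of nonnegative antitone functions. -/
lemma abs_tsum_sub_integral_le {φ f g : ℝ → ℝ} (J : ℕ) (h0 : ∀ t, 0 < t → 0 ≤ φ t)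
    (h1 : ∀ t, 0 < t → φ t ≤ 1) (hφ : IntegrableOn φ (Ioi 0))
    (hf : AntitoneOn f (Ici (J : ℝ))) (hg : AntitoneOn g (Ici (J : ℝ)))
    (hg0 : ∀ t ∈ Ici (J : ℝ), 0 ≤ g t) (hgf : ∀ t ∈ Ici (J : ℝ), g t ≤ f t)
    (hfi : IntegrableOn f (Ioi J)) (hgi : IntegrableOn g (Ioi J))
    (heq : ∀ t ∈ Ici (J : ℝ), φ t = f t - g t) :
    |(∑' j : ℕ, φ (j + 1)) - ∫ t in Ioi 0, φ t| ≤ J + f J := by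
  obtain ⟨hfs, hf1, hf2⟩ := hf.summable_and_integral_sub_tsum_mem
    (fun t ht => (hg0 t ht).trans (hgf t ht)) hfi
  obtain ⟨hgs, hg1, hg2⟩ := hg.summable_and_integral_sub_tsum_mem hg0 hgi
  have hJ : (0 : ℝ) ≤ J := J.cast_nonneg
  have hmem : ∀ n : ℕ, (J : ℝ) + (n + 1 : ℕ) ∈ Ici (J : ℝ) := fun n =>
    mem_Ici.mpr (le_add_of_nonneg_right (Nat.cast_nonneg _))
  have hterm : ∀ n : ℕ, φ ((n + J : ℕ) + 1) = f (J + (n + 1 : ℕ)) - g (J + (n + 1 : ℕ)) := by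
    intro n
    rw [← heq _ (hmem n)]
    push_cast
    ring_nf
  have hs : Summable fun n : ℕ => φ (n + 1) := by
    rw [← summable_nat_add_iff J]
    simp_rw [hterm]
    exact hfs.sub hgs
  have hsplit := hs.sum_add_tsum_nat_add J
  simp_rw [hterm] at hsplit
  rw [hfs.tsum_sub hgs] at hsplit
  have hisplit : ∫ t in Ioi 0, φ t = (∫ t in Ioc 0 (J : ℝ), φ t) +
      ((∫ t in Ioi (J : ℝ), f t) - ∫ t in Ioi (J : ℝ), g t) := by
    rw [← Ioc_union_Ioi_eq_Ioi hJ, setIntegral_union (Ioc_disjoint_Ioi le_rfl) measurableSet_Ioi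
      (hφ.mono_set Ioc_subset_Ioi_self) (hφ.mono_set (Ioi_subset_Ioi hJ)), ← integral_sub hfi hgi]
    congr 1
    exact setIntegral_congr_fun measurableSet_Ioi fun t ht => heq t (mem_Ici_of_Ioi ht)
  have hsum0 : 0 ≤ ∑ i ∈ Finset.range J, φ (i + 1) :=
    Finset.sum_nonneg fun i _ => h0 _ (by positivity)
  have hsum1 : ∑ i ∈ Finset.range J, φ (i + 1) ≤ J := by
    have := Finset.sum_le_card_nsmul (Finset.range J) (fun i : ℕ => φ (i + 1)) 1
      fun i _ => h1 _ (by positivity)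
    simpa using this
  have hInt0 : 0 ≤ ∫ t in Ioc 0 (J : ℝ), φ t :=
    setIntegral_nonneg measurableSet_Ioc fun t ht => h0 t ht.1
  have hInt1 : ∫ t in Ioc 0 (J : ℝ), φ t ≤ J := by
    have := setIntegral_mono_on (hφ.mono_set Ioc_subset_Ioi_self)
      (integrableOn_const (C := (1 : ℝ)) (s := Ioc 0 (J : ℝ)) (μ := volume) (by simp))
      measurableSet_Ioc fun t ht => h1 t ht.1
    simpa using this
  have hgfJ := hgf J self_mem_Ici
  rw [hisplit, ← hsplit, abs_le]
  constructor <;> linarith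

end SumIntegral

/-- A positive antitone function on `(0, ∞)` comparable to `t ↦ t ^ (-1 / D)`. -/
structure IsLengthProfile (ℓ : ℝ → ℝ) (D : ℝ) : Prop where
  mem : D ∈ Set.Ioo (0 : ℝ) 1
  anti : AntitoneOn ℓ (Set.Ioi 0)
  pos : ∀ t, 0 < t → 0 < ℓ t
  le : ∀ t, 0 < t → ℓ t ≤ (2 / t) ^ D⁻¹
  ge : ∀ t, 0 < t → (2⁻¹ / t) ^ D⁻¹ ≤ ℓ t

namespace IsLengthProfile

open Set

variable {ℓ : ℝ → ℝ} {D : ℝ}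

lemma one_lt_inv (H : IsLengthProfile ℓ D) : 1 < D⁻¹ := (one_lt_inv₀ H.mem.1).mpr H.mem.2

lemma aemeasurable (H : IsLengthProfile ℓ D) : AEMeasurable ℓ (volume.restrict (Ioi 0)) :=
  aemeasurable_restrict_of_antitoneOn measurableSet_Ioi H.anti

lemma integrableOn_of_le (H : IsLengthProfile ℓ D) {κ : ℝ → ℝ} (hκ : Measurable κ)
    (h0 : ∀ y, 0 < y → 0 ≤ κ y) (h1 : ∀ y, 0 < y → κ y ≤ y) {a x : ℝ} (ha : 0 < a) (hx : 0 < x) :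
    IntegrableOn (fun t => κ (ℓ t * x)) (Ioi a) := by
  have hi : IntegrableOn (fun t : ℝ => 2 ^ D⁻¹ * x * t ^ (-D⁻¹)) (Ioi a) :=
    (integrableOn_Ioi_rpow_of_lt (neg_lt_neg H.one_lt_inv) ha).const_mul _
  refine Integrable.mono' hi ?_ ?_
  · exact (hκ.comp_aemeasurable ((H.aemeasurable.mono_set (Ioi_subset_Ioi ha.le)).mul_const
      x)).aestronglyMeasurable
  · refine (ae_restrict_iff' measurableSet_Ioi).mpr (Eventually.of_forall fun t ht => ?_)
    have ht0 : 0 < t := ha.trans ht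
    have hy : 0 < ℓ t * x := mul_pos (H.pos t ht0) hx
    rw [Real.norm_of_nonneg (h0 _ hy)]
    calc κ (ℓ t * x) ≤ ℓ t * x := h1 _ hy
      _ ≤ (2 / t) ^ D⁻¹ * x := by gcongr; exact H.le t ht0
      _ = _ := by
        rw [Real.div_rpow zero_le_two ht0.le, Real.rpow_neg ht0.le]
        ring

lemma integrableOn_of_le_min (H : IsLengthProfile ℓ D) {κ : ℝ → ℝ} (hκ : Measurable κ)
    (h0 : ∀ y, 0 < y → 0 ≤ κ y) (h1 : ∀ y, 0 < y → κ y ≤ min y 1) {x : ℝ} (hx : 0 < x) :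
    IntegrableOn (fun t => κ (ℓ t * x)) (Ioi 0) := by
  rw [← Ioc_union_Ioi_eq_Ioi zero_le_one]
  refine IntegrableOn.union ?_ (H.integrableOn_of_le hκ h0
    (fun y hy => (h1 y hy).trans (min_le_left _ _)) one_pos hx)
  refine Integrable.mono' (integrableOn_const (C := (1 : ℝ)) (by simp)) ?_ ?_
  · exact (hκ.comp_aemeasurable ((H.aemeasurable.mono_set Ioc_subset_Ioi_self).mul_const
      x)).aestronglyMeasurable
  · refine (ae_restrict_iff' measurableSet_Ioc).mpr (Eventually.of_forall fun t ht => ?_)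
    have hy : 0 < ℓ t * x := mul_pos (H.pos t ht.1) hx
    rw [Real.norm_of_nonneg (h0 _ hy)]
    exact (h1 _ hy).trans (min_le_right _ _)

lemma anti_comp (H : IsLengthProfile ℓ D) {κ : ℝ → ℝ} (hκ : Monotone κ) {a x : ℝ} (ha : 0 < a)
    (hx : 0 < x) : AntitoneOn (fun t => κ (ℓ t * x)) (Ici a) := fun _ hs _ ht hst =>
  hκ (mul_le_mul_of_nonneg_right (H.anti (ha.trans_le hs) (ha.trans_le ht) hst) hx.le)

lemma abs_tsum_fract_sub_integral_le (H : IsLengthProfile ℓ D) {x : ℝ} (hx : 0 < x) {J : ℕ}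
    (hJ : 0 < J) :
    |(∑' j : ℕ, Int.fract (ℓ (j + 1) * x)) - ∫ t in Ioi 0, Int.fract (ℓ t * x)| ≤
      J + ℓ J * x := by
  have hJ' : (0 : ℝ) < J := by exact_mod_cast hJ
  have hfl : ∀ y : ℝ, 0 < y → (0 : ℝ) ≤ ⌊y⌋ := fun y hy => by
    exact_mod_cast Int.floor_nonneg.mpr hy.le
  have hpos : ∀ t ∈ Ici (J : ℝ), 0 < ℓ t * x := fun t ht => mul_pos (H.pos t (hJ'.trans_le ht)) hx
  refine abs_tsum_sub_integral_le (φ := fun t => Int.fract (ℓ t * x)) (f := fun t => ℓ t * x)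
    (g := fun t => (⌊ℓ t * x⌋ : ℝ)) J (fun t _ => Int.fract_nonneg _)
    (fun t _ => (Int.fract_lt_one _).le) ?_ (H.anti_comp monotone_id hJ' hx)
    (H.anti_comp (κ := fun y => (⌊y⌋ : ℝ)) (fun y z h => Int.cast_mono (Int.floor_mono h)) hJ' hx)
    (fun t ht => hfl _ (hpos t ht)) (fun t _ => Int.floor_le _) ?_ ?_
    (fun t _ => (Int.self_sub_floor _).symm)
  · exact H.integrableOn_of_le_min measurable_fract (fun y _ => Int.fract_nonneg y)
      (fun _ hy => fract_le_min hy) hx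
  · exact H.integrableOn_of_le measurable_id (fun y hy => hy.le) (fun y _ => le_rfl) hJ' hx
  · exact H.integrableOn_of_le (κ := fun y => (⌊y⌋ : ℝ)) (by fun_prop) hfl
      (fun y _ => Int.floor_le y) hJ' hx

lemma abs_tsum_min_sub_integral_le (H : IsLengthProfile ℓ D) {x : ℝ} (hx : 0 < x) :
    |(∑' j : ℕ, min (ℓ (j + 1) * x) 1) - ∫ t in Ioi 0, min (ℓ t * x) 1| ≤ 2 := by
  have hm : Measurable fun y : ℝ => min y 1 := measurable_id.min measurable_const
  have h0 : ∀ y : ℝ, 0 < y → 0 ≤ min y 1 := fun y hy => le_min hy.le zero_le_one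
  have hpos : ∀ t ∈ Ici ((1 : ℕ) : ℝ), 0 < t := fun t ht => by
    rw [Nat.cast_one] at ht
    exact one_pos.trans_le ht
  have h := abs_tsum_sub_integral_le (φ := fun t => min (ℓ t * x) 1)
    (f := fun t => min (ℓ t * x) 1) (g := fun _ => 0) 1
    (fun t ht => h0 _ (mul_pos (H.pos t ht) hx)) (fun t _ => min_le_right _ _)
    (H.integrableOn_of_le_min hm h0 (fun _ _ => le_rfl) hx)
    (H.anti_comp (κ := fun y => min y 1) (fun y z h => min_le_min_right 1 h) (by simp) hx)
    antitoneOn_const (fun _ _ => le_rfl) (fun t ht => h0 _ (mul_pos (H.pos t (hpos t ht)) hx))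
    (H.integrableOn_of_le hm h0 (fun _ _ => min_le_left _ _) (by simp) hx)
    (by simp) (fun _ _ => (sub_zero _).symm)
  refine h.trans ?_
  have := min_le_right (ℓ (1 : ℕ) * x) 1
  push_cast at this ⊢
  linarith

end IsLengthProfile

namespace FractalString

open Set

/-- The string of consecutive intervals with prescribed lengths. -/
noncomputable def ofLengths (l : ℕ → ℝ) (hpos : ∀ j, 0 < l j) (hanti : Antitone l)
    (hs : Summable l) : FractalString where
  a j := ∑ i ∈ Finset.range j, l i
  b j := ∑ i ∈ Finset.range (j + 1), l i
  lt j := by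
    rw [Finset.sum_range_succ]
    exact lt_add_of_pos_right _ (hpos j)
  disj := by
    have hmono : Monotone fun j => ∑ i ∈ Finset.range j, l i := fun i j hij =>
      Finset.sum_le_sum_of_subset_of_nonneg (Finset.range_mono hij) fun k _ _ => (hpos k).le
    exact hmono.pairwise_disjoint_on_Ioo_succ
  bdd := by
    refine (Metric.isBounded_Icc 0 (∑' i, l i)).subset (iUnion_subset fun j => ?_)
    refine Ioo_subset_Icc_self.trans (Icc_subset_Icc (Finset.sum_nonneg fun i _ => (hpos i).le) ?_)
    exact hs.sum_le_tsum _ fun i _ => (hpos i).le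
  anti i j hij := by
    simpa [Finset.sum_range_succ] using hanti hij

@[simp]
lemma l_ofLengths {l : ℕ → ℝ} (hpos : ∀ j, 0 < l j) (hanti : Antitone l) (hs : Summable l)
    (j : ℕ) : (ofLengths l hpos hanti hs).l j = l j := by
  simp [FractalString.l, ofLengths, Finset.sum_range_succ]

end FractalString

namespace IsLengthProfile

open Set

variable {ℓ : ℝ → ℝ} {D : ℝ}

lemma summable_rpow_iff (H : IsLengthProfile ℓ D) {σ : ℝ} :
    (Summable fun j : ℕ => ℓ (j + 1) ^ σ) ↔ D < σ := by
  have hD := H.mem.1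
  have hpos : ∀ j : ℕ, (0 : ℝ) < j + 1 := fun j => by positivity
  have hlpos : ∀ j : ℕ, 0 < ℓ (j + 1) := fun j => H.pos _ (hpos j)
  constructor
  · intro hs
    by_contra! hσ
    have hzero : Tendsto (fun j : ℕ => (2 / ((j : ℝ) + 1)) ^ D⁻¹) atTop (𝓝 0) := by
      have h1 : Tendsto (fun j : ℕ => 2 / ((j : ℝ) + 1)) atTop (𝓝 0) :=
        tendsto_const_nhds.div_atTop
          (tendsto_atTop_add_const_right _ 1 tendsto_natCast_atTop_atTop)
      have h2 := h1.rpow_const (p := D⁻¹) (Or.inr (inv_nonneg.mpr hD.le))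
      rwa [Real.zero_rpow (inv_ne_zero hD.ne')] at h2
    have hev : ∀ᶠ j : ℕ in atTop, ‖((2⁻¹ : ℝ) / ((j : ℝ) + 1))‖ ≤ ‖ℓ (j + 1) ^ σ‖ := by
      filter_upwards [hzero.eventually_le_const one_pos] with j hj
      rw [Real.norm_of_nonneg (div_pos (by norm_num) (hpos j)).le,
        Real.norm_of_nonneg (Real.rpow_nonneg (hlpos j).le _)]
      have h1 := Real.rpow_le_rpow (Real.rpow_nonneg (div_pos (by norm_num) (hpos j)).le _)
        (H.ge _ (hpos j)) hD.le
      rw [Real.rpow_inv_rpow (div_pos (by norm_num) (hpos j)).le hD.ne'] at h1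
      exact h1.trans (Real.rpow_le_rpow_of_exponent_ge (hlpos j) ((H.le _ (hpos j)).trans hj) hσ)
    have h1 : Summable fun j : ℕ => (2⁻¹ : ℝ) / ((j : ℝ) + 1) :=
      summable_of_isBigO_nat hs (IsBigO.of_bound 1 (hev.mono fun j hj => by rwa [one_mul]))
    have h2 : Summable fun j : ℕ => 1 / ((j + 1 : ℕ) : ℝ) := by
      refine (h1.mul_left 2).congr fun j => ?_
      push_cast
      ring
    exact Real.not_summable_one_div_natCast ((summable_nat_add_iff 1).mp h2)
  · intro hσ
    have hσ0 : 0 < σ := hD.trans hσ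
    have h1 : Summable fun j : ℕ => 2 ^ (D⁻¹ * σ) * ((j + 1 : ℕ) : ℝ) ^ (-(D⁻¹ * σ)) := by
      refine Summable.mul_left _ ((summable_nat_add_iff 1).mpr (Real.summable_nat_rpow.mpr ?_))
      rw [neg_lt_neg_iff, inv_mul_eq_div, one_lt_div hD]
      exact hσ
    refine Summable.of_nonneg_of_le (fun j => Real.rpow_nonneg (hlpos j).le _) (fun j => ?_) h1
    calc ℓ (j + 1) ^ σ ≤ ((2 / ((j : ℝ) + 1)) ^ D⁻¹) ^ σ :=
          Real.rpow_le_rpow (hlpos j).le (H.le _ (hpos j)) hσ0.le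
      _ = _ := by
        rw [← Real.rpow_mul (by positivity), Real.div_rpow zero_le_two (hpos j).le,
          Real.rpow_neg (by positivity)]
        push_cast
        ring

/-- The fractal string with lengths `ℓ 1, ℓ 2, …`. -/
noncomputable def string (H : IsLengthProfile ℓ D) : FractalString :=
  FractalString.ofLengths (fun j => ℓ (j + 1)) (fun j => H.pos _ (by positivity))
    (fun i j hij => H.anti (mem_Ioi.mpr (by positivity)) (mem_Ioi.mpr (by positivity))
      (by gcongr)) (by simpa using H.summable_rpow_iff.mpr H.mem.2)

@[simp]
lemma l_string (H : IsLengthProfile ℓ D) (j : ℕ) : H.string.l j = ℓ (j + 1) :=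
  FractalString.l_ofLengths _ _ _ j

lemma dimension_string (H : IsLengthProfile ℓ D) : H.string.dimension = D := by
  simp_rw [FractalString.dimension, l_string, H.summable_rpow_iff]
  exact csInf_Ioi

/-- If the spectral integral of the profile is an exact power, the string has a monofractal
spectral asymptotic formula with error term. -/
lemma isBigO_Nnu_string (H : IsLengthProfile ℓ D) {c : ℝ}
    (hc : ∀ x, 0 < x → ∫ t in Ioi 0, Int.fract (ℓ t * x) = c * x ^ D) :
    (fun x : ℝ => H.string.Nnu x - (H.string.weyl x - c * x ^ D)) =O[atTop]
      fun x : ℝ => x ^ (D - (D - D / (1 + D))) := by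
  have hD := H.mem.1
  rw [sub_sub_cancel]
  refine IsBigO.of_bound (2 + 2 ^ D⁻¹) ?_
  filter_upwards [eventually_ge_atTop 1] with x hx
  have hx0 : 0 < x := one_pos.trans_le hx
  set y := x ^ (D / (1 + D)) with hy
  have hy1 : 1 ≤ y := Real.one_le_rpow hx (by positivity)
  have hy0 : 0 < y := one_pos.trans_le hy1
  have hJ : 0 < ⌈y⌉₊ := Nat.ceil_pos.mpr hy0
  have hJy : y ≤ ⌈y⌉₊ := Nat.le_ceil y
  have hJ2 : (⌈y⌉₊ : ℝ) ≤ 2 * y := by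
    have := Nat.ceil_lt_add_one hy0.le
    linarith
  have h1 := H.abs_tsum_fract_sub_integral_le hx0 hJ
  rw [hc x hx0] at h1
  have h2 : ℓ ⌈y⌉₊ * x ≤ 2 ^ D⁻¹ * y := by
    have hyx : y ^ (-D⁻¹) * x = y := by
      rw [hy, ← Real.rpow_mul hx0.le]
      nth_rewrite 2 [← Real.rpow_one x]
      rw [← Real.rpow_add hx0]
      congr 1
      field_simp
      ring
    calc ℓ ⌈y⌉₊ * x ≤ (2 / (⌈y⌉₊ : ℝ)) ^ D⁻¹ * x := by
          gcongr
          exact H.le _ (by exact_mod_cast hJ)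
      _ ≤ (2 / y) ^ D⁻¹ * x := by gcongr
      _ = 2 ^ D⁻¹ * (y ^ (-D⁻¹) * x) := by
          rw [Real.div_rpow zero_le_two hy0.le, Real.rpow_neg hy0.le]
          ring
      _ = _ := by rw [hyx]
  rw [FractalString.Nnu_eq _ hx0.le, FractalString.fractSum, sub_sub_sub_cancel_left, norm_sub_rev,
    Real.norm_eq_abs, Real.norm_of_nonneg hy0.le]
  simp_rw [l_string]
  linarith

lemma abs_minSum_string_sub_le (H : IsLengthProfile ℓ D) {x : ℝ} (hx : 0 < x) :
    |H.string.minSum x - ∫ t in Ioi 0, min (ℓ t * x) 1| ≤ 2 := by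
  simp_rw [FractalString.minSum, l_string]
  exact H.abs_tsum_min_sub_integral_le hx

end IsLengthProfile

section Oscillation

open Set

/-- Amplitude of the oscillating perturbation, small enough to keep `oscCount` monotone. -/
noncomputable def oscCoeff (D τ : ℝ) : ℝ := D / (2 * (D + |τ|))

/-- The power law `u ^ (-D)` perturbed by oscillations of frequency `τ`. -/
noncomputable def oscCount (D τ u : ℝ) : ℝ :=
  u ^ (-D) * (1 + oscCoeff D τ * Real.cos (τ * Real.log u))

/-- Minus the derivative of `oscCount`. -/
noncomputable def oscDensity (D τ u : ℝ) : ℝ :=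
  u ^ (-D - 1) * (D + oscCoeff D τ * (D * Real.cos (τ * Real.log u) + τ * Real.sin (τ * Real.log u)))

variable {D τ : ℝ}

lemma oscCoeff_pos (hD : 0 < D) : 0 < oscCoeff D τ := by
  unfold oscCoeff
  positivity

lemma oscCoeff_mul (hD : 0 < D) : oscCoeff D τ * (D + |τ|) = D / 2 := by
  have : 0 < D + |τ| := by positivity
  unfold oscCoeff
  field_simp

lemma oscCoeff_le_half (hD : 0 < D) : oscCoeff D τ ≤ 2⁻¹ := by
  unfold oscCoeff
  rw [div_le_iff₀ (by positivity)]
  linarith [abs_nonneg τ]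

lemma hasDerivAt_oscCount {u : ℝ} (hu : 0 < u) :
    HasDerivAt (oscCount D τ) (-oscDensity D τ u) u := by
  have h1 := (Real.hasDerivAt_rpow_const (p := -D) (Or.inl hu.ne')).mul
    ((((Real.hasDerivAt_log hu.ne').const_mul τ).cos.const_mul (oscCoeff D τ)).const_add 1)
  refine h1.congr_deriv ?_
  have h2 : u ^ (-D) = u ^ (-D - 1) * u := by
    rw [← Real.rpow_add_one hu.ne', sub_add_cancel]
  rw [oscDensity, h2]
  field_simp
  ring

lemma abs_osc_le (D τ θ : ℝ) (hD : 0 < D) : |D * Real.cos θ + τ * Real.sin θ| ≤ D + |τ| := by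
  refine (abs_add_le _ _).trans ?_
  rw [abs_mul, abs_mul, abs_of_pos hD]
  have h1 := mul_le_of_le_one_right hD.le (Real.abs_cos_le_one θ)
  have h2 := mul_le_of_le_one_right (abs_nonneg τ) (Real.abs_sin_le_one θ)
  linarith

lemma oscDensity_pos (hD : 0 < D) {u : ℝ} (hu : 0 < u) : 0 < oscDensity D τ u := by
  refine mul_pos (Real.rpow_pos_of_pos hu _) ?_
  have h1 := (abs_le.mp (abs_osc_le D τ (τ * Real.log u) hD)).1
  have h2 := mul_le_mul_of_nonneg_left h1 (oscCoeff_pos (τ := τ) hD).le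
  have h3 := oscCoeff_mul (τ := τ) hD
  linarith

lemma strictAntiOn_oscCount (hD : 0 < D) : StrictAntiOn (oscCount D τ) (Ioi 0) := by
  refine strictAntiOn_of_deriv_neg (convex_Ioi 0)
    (fun u hu => (hasDerivAt_oscCount hu).continuousAt.continuousWithinAt) fun u hu => ?_
  rw [interior_Ioi] at hu
  rw [(hasDerivAt_oscCount hu).deriv]
  exact neg_neg_of_pos (oscDensity_pos hD hu)

lemma oscCount_le (hD : 0 < D) {u : ℝ} (hu : 0 < u) : oscCount D τ u ≤ 2 * u ^ (-D) := by
  rw [oscCount, mul_comm]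
  gcongr
  have h1 := oscCoeff_le_half (τ := τ) hD
  have h2 := mul_le_of_le_one_right (oscCoeff_pos (τ := τ) hD).le
    (Real.cos_le_one (τ * Real.log u))
  linarith

lemma le_oscCount (hD : 0 < D) {u : ℝ} (hu : 0 < u) : 2⁻¹ * u ^ (-D) ≤ oscCount D τ u := by
  rw [oscCount, mul_comm (u ^ (-D))]
  gcongr
  have h1 := oscCoeff_le_half (τ := τ) hD
  have h2 := mul_le_mul_of_nonneg_left (Real.neg_one_le_cos (τ * Real.log u))
    (oscCoeff_pos (τ := τ) hD).le
  linarith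

lemma oscCount_pos (hD : 0 < D) {u : ℝ} (hu : 0 < u) : 0 < oscCount D τ u :=
  (by positivity : 0 < 2⁻¹ * u ^ (-D)).trans_le (le_oscCount hD hu)

lemma exists_oscCount_eq (hD : 0 < D) {t : ℝ} (ht : 0 < t) :
    ∃ u ∈ Icc ((2⁻¹ / t) ^ D⁻¹) ((2 / t) ^ D⁻¹), oscCount D τ u = t := by
  have h0 : 0 < (2⁻¹ / t) ^ D⁻¹ := by positivity
  have h1 : 0 < (2 / t) ^ D⁻¹ := by positivity
  have hle : (2⁻¹ / t) ^ D⁻¹ ≤ (2 / t) ^ D⁻¹ := by gcongr; norm_num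
  have hpow : ∀ y : ℝ, 0 < y → (y ^ D⁻¹) ^ (-D) = y⁻¹ := fun y hy => by
    rw [← Real.rpow_mul hy.le, mul_neg, inv_mul_cancel₀ hD.ne', Real.rpow_neg_one]
  have hcont : ContinuousOn (oscCount D τ) (Icc ((2⁻¹ / t) ^ D⁻¹) ((2 / t) ^ D⁻¹)) := fun u hu =>
    (hasDerivAt_oscCount (h0.trans_le hu.1)).continuousAt.continuousWithinAt
  refine intermediate_value_Icc' hle hcont ⟨?_, ?_⟩
  · refine (oscCount_le hD h1).trans (le_of_eq ?_)
    rw [hpow _ (by positivity), inv_div]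
    field_simp
  · refine (le_of_eq ?_).trans (le_oscCount hD h0)
    rw [hpow _ (by positivity), inv_div]
    field_simp

lemma exists_isLengthProfile (hD : D ∈ Ioo (0 : ℝ) 1) (τ : ℝ) :
    ∃ ℓ, IsLengthProfile ℓ D ∧ (∀ t, 0 < t → oscCount D τ (ℓ t) = t) ∧
      ∀ u, 0 < u → ℓ (oscCount D τ u) = u := by
  have h : ∀ t : ℝ, ∃ u, 0 < t → u ∈ Icc ((2⁻¹ / t) ^ D⁻¹) ((2 / t) ^ D⁻¹) ∧
      oscCount D τ u = t := fun t => by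
    by_cases ht : 0 < t
    · obtain ⟨u, hu⟩ := exists_oscCount_eq (τ := τ) hD.1 ht
      exact ⟨u, fun _ => hu⟩
    · exact ⟨0, fun h => absurd h ht⟩
  choose ℓ hℓ using h
  have hpos : ∀ t, 0 < t → 0 < ℓ t := fun t ht =>
    (by positivity : 0 < (2⁻¹ / t) ^ D⁻¹).trans_le (hℓ t ht).1.1
  refine ⟨ℓ, ⟨hD, fun t ht t' ht' htt => ?_, hpos, fun t ht => (hℓ t ht).1.2,
    fun t ht => (hℓ t ht).1.1⟩, fun t ht => (hℓ t ht).2, fun u hu => ?_⟩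
  · rw [← (strictAntiOn_oscCount (τ := τ) hD.1).le_iff_ge (hpos t ht) (hpos t' ht'),
      (hℓ t ht).2, (hℓ t' ht').2]
    exact htt
  · have ht := oscCount_pos (τ := τ) hD.1 hu
    exact (strictAntiOn_oscCount (τ := τ) hD.1).injOn (hpos _ ht) hu (hℓ _ ht).2

lemma image_oscCount (hD : 0 < D) : oscCount D τ '' Ioi 0 = Ioi 0 := by
  refine Subset.antisymm (image_subset_iff.mpr fun u hu => oscCount_pos hD hu) fun t ht => ?_
  obtain ⟨u, hu, h⟩ := exists_oscCount_eq (τ := τ) hD ht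
  have h0 : 0 < (2⁻¹ / t) ^ D⁻¹ := Real.rpow_pos_of_pos (div_pos (by norm_num) ht) _
  exact ⟨u, h0.trans_le hu.1, h⟩

lemma integral_comp_profile (hD : 0 < D) {ℓ : ℝ → ℝ}
    (hℓ : ∀ u, 0 < u → ℓ (oscCount D τ u) = u) (f : ℝ → ℝ) :
    ∫ t in Ioi 0, f (ℓ t) = ∫ u in Ioi 0, oscDensity D τ u * f u := by
  have h := integral_image_eq_integral_abs_deriv_smul (measurableSet_Ioi (a := (0 : ℝ)))
    (fun u hu => (hasDerivAt_oscCount (D := D) (τ := τ) hu).hasDerivWithinAt)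
    (strictAntiOn_oscCount hD).injOn (fun t => f (ℓ t))
  rw [image_oscCount hD] at h
  rw [h]
  refine setIntegral_congr_fun measurableSet_Ioi fun u hu => ?_
  simp only [smul_eq_mul]
  rw [hℓ u hu, abs_neg, abs_of_pos (oscDensity_pos hD hu)]

lemma oscDensity_eq_re {u : ℝ} (hu : 0 < u) :
    oscDensity D τ u = ((D : ℂ) * (u : ℂ) ^ (-(D : ℂ) - 1) +
      oscCoeff D τ * (D + τ * Complex.I) * (u : ℂ) ^ (-((D : ℂ) + τ * Complex.I) - 1)).re := by
  have h1 : (u : ℂ) ^ (-(D : ℂ) - 1) = ((u ^ (-D - 1) : ℝ) : ℂ) := by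
    rw [Complex.ofReal_cpow hu.le]
    push_cast
    rfl
  have h2 : (u : ℂ) ^ (-((D : ℂ) + τ * Complex.I) - 1) = ((u ^ (-D - 1) : ℝ) : ℂ) *
      (Real.cos (τ * Real.log u) - Real.sin (τ * Real.log u) * Complex.I) := by
    have hu0 : (u : ℂ) ≠ 0 := by exact_mod_cast hu.ne'
    rw [← h1, show -((D : ℂ) + τ * Complex.I) - 1 = (-(D : ℂ) - 1) + -(τ * Complex.I) by ring,
      Complex.cpow_add _ _ hu0, Complex.cpow_def_of_ne_zero hu0 (-(τ * Complex.I)),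
      ← Complex.ofReal_log hu.le,
      show (Real.log u : ℂ) * -(τ * Complex.I) = ((-(τ * Real.log u) : ℝ) : ℂ) * Complex.I by
        push_cast; ring,
      Complex.exp_mul_I, ← Complex.ofReal_cos, ← Complex.ofReal_sin, Real.cos_neg, Real.sin_neg]
    push_cast
    ring
  rw [h1, h2, oscDensity]
  simp [-Complex.ofReal_cos, -Complex.ofReal_sin]
  ring

/-- The Mellin transform evaluates integrals against `oscDensity`. -/
lemma integral_oscDensity_mul {κ : ℝ → ℝ} {m₀ m₁ : ℂ}
    (h₀ : HasMellin (fun t : ℝ => (κ t : ℂ)) (-(D : ℂ)) m₀)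
    (h₁ : HasMellin (fun t : ℝ => (κ t : ℂ)) (-((D : ℂ) + τ * Complex.I)) m₁)
    {x : ℝ} (hx : 0 < x) :
    ∫ u in Ioi 0, oscDensity D τ u * κ (u * x) =
      (D * (x : ℂ) ^ (D : ℂ) * m₀ +
        oscCoeff D τ * (D + τ * Complex.I) * (x : ℂ) ^ ((D : ℂ) + τ * Complex.I) * m₁).re := by
  have key : ∀ {z m : ℂ}, HasMellin (fun t : ℝ => (κ t : ℂ)) (-z) m →
      IntegrableOn (fun u : ℝ => (u : ℂ) ^ (-z - 1) * (κ (u * x) : ℂ)) (Ioi 0) ∧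
      ∫ u in Ioi (0 : ℝ), (u : ℂ) ^ (-z - 1) * (κ (u * x) : ℂ) = (x : ℂ) ^ z * m := by
    intro z m h
    have hi := (MellinConvergent.comp_mul_left (f := fun t : ℝ => (κ t : ℂ)) (s := -z) hx).mpr h.1
    have he := mellin_comp_mul_left (fun t : ℝ => (κ t : ℂ)) (-z) hx
    rw [h.2, neg_neg] at he
    simp only [MellinConvergent, mellin, smul_eq_mul, mul_comm x] at hi he
    exact ⟨hi, he⟩
  obtain ⟨hi₀, he₀⟩ := key h₀
  obtain ⟨hi₁, he₁⟩ := key h₁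
  have hsum := integral_add (hi₀.const_mul (D : ℂ))
    (hi₁.const_mul (oscCoeff D τ * (D + τ * Complex.I) : ℂ))
  rw [integral_const_mul, integral_const_mul, he₀, he₁] at hsum
  rw [show (D * (x : ℂ) ^ (D : ℂ) * m₀ +
        oscCoeff D τ * (D + τ * Complex.I) * (x : ℂ) ^ ((D : ℂ) + τ * Complex.I) * m₁) =
      D * ((x : ℂ) ^ (D : ℂ) * m₀) +
        oscCoeff D τ * (D + τ * Complex.I) * ((x : ℂ) ^ ((D : ℂ) + τ * Complex.I) * m₁) by ring,
    ← hsum]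
  refine Eq.trans ?_ (Complex.reCLM.integral_comp_comm ((hi₀.const_mul (D : ℂ)).add
    (hi₁.const_mul (oscCoeff D τ * (D + τ * Complex.I) : ℂ))))
  refine setIntegral_congr_fun measurableSet_Ioi fun u hu => ?_
  simp only [Complex.reCLM_apply]
  rw [oscDensity_eq_re hu, ← Complex.re_mul_ofReal]
  congr 1
  ring

end Oscillation

/-- The Mellin transform of the fractional part is positive on `(-1, 0)`; in particular `ζ` is
negative on `(0, 1)`. -/
lemma exists_pos_hasMellin_fract {D : ℝ} (hD : D ∈ Set.Ioo (0 : ℝ) 1) :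
    ∃ p : ℝ, 0 < p ∧ HasMellin (fun t : ℝ => ((Int.fract t : ℝ) : ℂ)) (-(D : ℂ)) p ∧
      riemannZeta D = ((-(D * p) : ℝ) : ℂ) := by
  have hM := hasMellin_fract (s := D) (by simpa using hD.1) (by simpa using hD.2)
  have hF := fourier_logKernel D Int.fract 0
  rw [mul_zero, neg_zero, Complex.ofReal_zero, zero_mul, add_zero, hM.2] at hF
  rw [Real.fourier_real_eq] at hF
  simp only [mul_zero, neg_zero, AddChar.map_zero_eq_one, one_smul] at hF
  rw [(integral_logKernel_nonneg fun y _ => Int.fract_nonneg y).1] at hF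
  have h0 : ∀ u, 0 ≤ logKernel D Int.fract u := logKernel_nonneg fun y _ => Int.fract_nonneg y
  have hδ : 0 < min D (1 - D) := lt_min hD.1 (sub_pos.mpr hD.2)
  have hInt : Integrable (logKernel D Int.fract) := by
    have := (integrable_of_exp_decay (measurable_logKernel measurable_fract) hδ
      (abs_logKernel_le (D := D) (fun y _ => Int.fract_nonneg y) fun y hy => fract_le_min hy)).re
    simpa using this
  have hpos : 0 < ∫ u, logKernel D Int.fract u := by
    rw [integral_pos_iff_support_of_nonneg h0 hInt]
    refine (by simp : (0 : ENNReal) < volume (Set.Ioi (0 : ℝ))).trans_le (measure_mono fun u hu => ?_)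
    have h1 : Int.fract (Real.exp (-u)) = Real.exp (-u) :=
      Int.fract_eq_self.mpr ⟨Real.exp_nonneg _, Real.exp_lt_one_iff.mpr (neg_neg_of_pos hu)⟩
    rw [Function.mem_support, logKernel, h1]
    positivity
  refine ⟨_, hpos, ⟨hM.1, hM.2.trans hF.symm⟩, ?_⟩
  have hD0 : (D : ℂ) ≠ 0 := by exact_mod_cast hD.1.ne'
  push_cast
  rw [hF]
  field_simp

/-- A nontrivial oscillation has no limit. -/
lemma eq_zero_of_tendsto_re_exp_mul {τ A : ℝ} {z : ℂ} (hτ : τ ≠ 0)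
    (h : Tendsto (fun y : ℝ => (Complex.exp ((τ * y : ℝ) * Complex.I) * z).re) atTop (𝓝 A)) :
    z = 0 := by
  obtain ⟨ε, hε⟩ : ∃ ε : ℤ, 0 < (ε : ℝ) / τ := by
    rcases hτ.lt_or_gt with h | h
    · exact ⟨-1, by simpa using div_pos_of_neg_of_neg neg_one_lt_zero h⟩
    · exact ⟨1, by simpa using h⟩
  have key : ∀ θ : ℝ, (Complex.exp (θ * Complex.I) * z).re = A := by
    intro θ
    have hy : Tendsto (fun n : ℕ => θ / τ + (n : ℝ) * (2 * Real.pi * (ε / τ))) atTop atTop :=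
      tendsto_atTop_add_const_left _ _
        (tendsto_natCast_atTop_atTop.atTop_mul_const (by positivity))
    refine tendsto_nhds_unique ((tendsto_const_nhds (f := atTop)).congr fun n : ℕ => ?_) (h.comp hy)
    simp only [Function.comp_apply]
    have h1 : ((τ * (θ / τ + (n : ℝ) * (2 * Real.pi * (ε / τ))) : ℝ) : ℂ) * Complex.I =
        θ * Complex.I + ((n * ε : ℤ) : ℂ) * (2 * Real.pi * Complex.I) := by
      have : τ * (θ / τ + (n : ℝ) * (2 * Real.pi * (ε / τ))) = θ + n * ε * (2 * Real.pi) := by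
        field_simp
      rw [this]
      push_cast
      ring
    rw [h1, Complex.exp_add, Complex.exp_int_mul_two_pi_mul_I, mul_one]
  have h0 := key 0
  have h1 := key Real.pi
  have h2 := key (Real.pi / 2)
  have h3 := key (-Real.pi / 2)
  push_cast at h0 h1 h2 h3
  rw [zero_mul, Complex.exp_zero, one_mul] at h0
  rw [Complex.exp_pi_mul_I, neg_one_mul, Complex.neg_re] at h1
  rw [Complex.exp_pi_div_two_mul_I] at h2
  rw [Complex.exp_neg_pi_div_two_mul_I] at h3
  simp only [neg_mul, Complex.neg_re, Complex.I_mul_re] at h2 h3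
  exact Complex.ext (by simp; linarith) (by simp; linarith)

/-- A zero of `ζ` on `Re s = D` produces a counterexample to the inverse spectral problem. -/
theorem exists_not_minkowskiMeasurable_of_riemannZeta_eq_zero {D τ : ℝ}
    (hD : D ∈ Set.Ioo (0 : ℝ) 1) (hζ : riemannZeta (D + τ * Complex.I) = 0) :
    ∃ S : FractalString, S.dimension = D ∧
      (∃ cD : ℝ, 0 < cD ∧ ∃ δ : ℝ, 0 < δ ∧
        (fun x : ℝ => S.Nnu x - (S.weyl x - cD * x ^ D)) =O[atTop] fun x : ℝ => x ^ (D - δ)) ∧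
      ¬ S.MinkowskiMeasurable D := by
  have hD0 := hD.1
  have hD1 := hD.2
  obtain ⟨p, hp, hMp, hζD⟩ := exists_pos_hasMellin_fract hD
  have hre : ((D : ℂ) + τ * Complex.I).re = D := by simp
  have hτ : τ ≠ 0 := by
    rintro rfl
    rw [Complex.ofReal_zero, zero_mul, add_zero, hζD] at hζ
    have : -(D * p) = 0 := by exact_mod_cast hζ
    linarith [mul_pos hD0 hp]
  have hMs := hasMellin_fract (s := D + τ * Complex.I) (by rwa [hre]) (by rwa [hre])
  rw [hζ, neg_zero, zero_div] at hMs
  have hmin₀ := hasMellin_min (s := D) (by simpa using hD0) (by simpa using hD1)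
  have hmin₁ := hasMellin_min (s := D + τ * Complex.I) (by rwa [hre]) (by rwa [hre])
  obtain ⟨ℓ, H, -, hℓ⟩ := exists_isLengthProfile hD τ
  refine ⟨H.string, H.dimension_string, ⟨D * p, by positivity, D - D / (1 + D), ?_,
    H.isBigO_Nnu_string fun x hx => ?_⟩, ?_⟩
  · rw [sub_pos, div_lt_iff₀ (by positivity)]
    nlinarith
  · rw [integral_comp_profile hD0 hℓ fun y => Int.fract (y * x), integral_oscDensity_mul hMp hMs hx,
      mul_zero, add_zero, ← Complex.ofReal_cpow hx.le, ← Complex.ofReal_mul, ← Complex.ofReal_mul,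
      Complex.ofReal_re]
    ring
  · rintro ⟨M, -, hM⟩
    rw [FractalString.minkTendsto_iff] at hM
    set s : ℂ := D + τ * Complex.I with hs
    have hs0 : s ≠ 0 := fun h => hD0.ne' (by rw [← hre, h, Complex.zero_re])
    have hs1 : 1 - s ≠ 0 := fun h => by
      have := congrArg Complex.re h
      rw [Complex.sub_re, hre] at this
      simp only [Complex.one_re, Complex.zero_re] at this
      linarith
    have hval : ∀ x : ℝ, 0 < x → ∫ t in Set.Ioi 0, min (ℓ t * x) 1 =
        x ^ D * (1 / (1 - D)) +
          x ^ D * (Complex.exp ((τ * Real.log x : ℝ) * Complex.I) * (oscCoeff D τ / (1 - s))).re := by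
      intro x hx
      have hx0 : (x : ℂ) ≠ 0 := by exact_mod_cast hx.ne'
      have hDc : (D : ℂ) ≠ 0 := by exact_mod_cast hD0.ne'
      have hDc1 : (1 - D : ℂ) ≠ 0 := by exact_mod_cast (sub_pos.mpr hD1).ne'
      have hexp : (x : ℂ) ^ s =
          (x ^ D : ℝ) * Complex.exp ((τ * Real.log x : ℝ) * Complex.I) := by
        rw [hs, Complex.cpow_add _ _ hx0, ← Complex.ofReal_cpow hx.le,
          Complex.cpow_def_of_ne_zero hx0 (τ * Complex.I), ← Complex.ofReal_log hx.le]
        congr 2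
        push_cast
        ring
      rw [integral_comp_profile hD0 hℓ fun y => min (y * x) 1,
        integral_oscDensity_mul hmin₀ hmin₁ hx, ← hs, hexp, ← Complex.ofReal_cpow hx.le]
      have h1 : (D : ℂ) * (x ^ D : ℝ) * (1 / (D * (1 - D))) = ((x ^ D * (1 / (1 - D)) : ℝ) : ℂ) := by
        push_cast
        field_simp
      have h2 : (oscCoeff D τ : ℂ) * s *
          ((x ^ D : ℝ) * Complex.exp ((τ * Real.log x : ℝ) * Complex.I)) * (1 / (s * (1 - s))) =
          (x ^ D : ℝ) * (Complex.exp ((τ * Real.log x : ℝ) * Complex.I) *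
            (oscCoeff D τ / (1 - s))) := by
        field_simp
      rw [h1, h2, Complex.add_re, Complex.ofReal_re, Complex.re_ofReal_mul]
    have herr : Tendsto (fun x : ℝ => x ^ (-D) *
        (H.string.minSum x - ∫ t in Set.Ioi 0, min (ℓ t * x) 1)) atTop (𝓝 0) := by
      refine squeeze_zero_norm' ?_ (by simpa using (tendsto_rpow_neg_atTop hD0).mul_const 2)
      filter_upwards [eventually_gt_atTop 0] with x hx
      rw [norm_mul, Real.norm_of_nonneg (Real.rpow_nonneg hx.le _), Real.norm_eq_abs]
      exact mul_le_mul_of_nonneg_left (H.abs_minSum_string_sub_le hx) (Real.rpow_nonneg hx.le _)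
    have hosc := ((hM.sub herr).sub_const (1 / (1 - D))).comp Real.tendsto_exp_atTop
    have hz := eq_zero_of_tendsto_re_exp_mul (z := oscCoeff D τ / (1 - s)) hτ (hosc.congr fun y => ?_)
    · refine div_ne_zero ?_ hs1 hz
      exact_mod_cast (oscCoeff_pos hD0).ne'
    · have hy := Real.exp_pos y
      have hpow : Real.exp y ^ (-D) * Real.exp y ^ D = 1 := by
        rw [← Real.rpow_add hy, neg_add_cancel, Real.rpow_zero]
      simp only [Function.comp_apply]
      rw [hval _ hy, Real.log_exp]
      linear_combination (1 / (1 - D) +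
        (Complex.exp ((τ * y : ℝ) * Complex.I) * (oscCoeff D τ / (1 - s))).re) * hpow

/-- For fixed `D ∈ (0,1)`: the Riemann zeta function has no zeroes on the
vertical line `Re(s) = D` if and only if the inverse spectral problem has a
positive answer for every ordinary fractal string of dimension `D`: whenever
`N_ν(x) = W(x) - c_D x^D + O(x^{D-δ})` for some `c_D > 0`, `δ > 0`, the string
is Minkowski measurable of dimension `D`. -/
theorem zeroFree_line_iff_inverseSpectralProblem (D : ℝ)
    (hD : D ∈ Set.Ioo (0 : ℝ) 1) :
    (∀ τ : ℝ, riemannZeta (D + τ * Complex.I) ≠ 0) ↔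
      ∀ S : FractalString, S.dimension = D →
        (∃ cD : ℝ, 0 < cD ∧ ∃ δ : ℝ, 0 < δ ∧
          (fun x : ℝ => S.Nnu x - (S.weyl x - cD * x ^ D)) =O[atTop]
            fun x : ℝ => x ^ (D - δ)) →
        S.MinkowskiMeasurable D := by
  constructor
  · rintro hζ S - ⟨c, hc, δ, hδ, h⟩
    exact S.minkowskiMeasurable_of_riemannZeta_ne_zero hD hζ hc hδ h
  · intro h τ hζ
    obtain ⟨S, hS, hexp, hM⟩ := exists_not_minkowskiMeasurable_of_riemannZeta_eq_zero hD hζ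
    exact hM (h S hS hexp)
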